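/- There exists a constant Θ ≥ 1 such that the following holds. Let T₁ ≤ T₂ with T₁ ≥ Θ, and let (ρ, T, f) and (ρ̃, T̃, f̃) be two triples where ρ, ρ̃ : [0,1] → (0,∞) are measurable, bounded, with ∫₀¹ ρ = ∫₀¹ ρ̃ = 1; T, T̃ : [0,1] → (0,∞) are measurable with T₁ ≤ T(y), T̃(y) ≤ T₂ for all y; and f, f̃ are mild steady states of the linear BGK equation with data (κ, T₁, T₂, ρ, T) and (κ, T₁, T₂, ρ̃, T̃) respectively, with κ = 1. Assume the pressures P(x) = ∫ v² f(x,v) dv and P̃(x) = ∫ v² f̃(x,v) dv are constant in x, and set τ(x) = P(x)/ρ(x), τ̃(x) = P̃(x)/ρ̃(x). Then there exist constants C and Λ depending only on T₁ and T₂ such that sup_{x∈[0,1]} |ρ(x) − ρ̃(x)| ≤ C T₁^{−1/2} sup_{y∈[0,1]} |√(T(y)) − √(T̃(y))| and sup_{x∈[0,1]} |τ(x) − τ̃(x)| ≤ Λ sup_{y∈[0,1]} |√(T(y)) − √(T̃(y))|; i.e. the steady-state map T ↦ τ is continuous in the uniform norm. -/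

import Mathlib

open MeasureTheory Real Set

/-- Centered Maxwellian with temperature `T`: `M_T(v) = (2πT)^{-1/2} exp(−v²/(2T))`. -/
noncomputable def Mxw (T v : ℝ) : ℝ :=
  (Real.sqrt (2 * π * T))⁻¹ * Real.exp (-v ^ 2 / (2 * T))

/-- Wall Maxwellian with temperature `T`: `M̃_T(v) = (1/T) exp(−v²/(2T))`,
normalized so that `∫₀^∞ v M̃_T(v) dv = 1`. -/
noncomputable def wallMxw (T v : ℝ) : ℝ :=
  T⁻¹ * Real.exp (-v ^ 2 / (2 * T))

/-- `C_i = ∫₀^∞ v e^{−1/(κv)} M̃_{T_i}(v) dv`. -/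
noncomputable def Cwall (κ T : ℝ) : ℝ :=
  ∫ v in Ioi (0 : ℝ), v * Real.exp (-1 / (κ * v)) * wallMxw T v

/-- `C₋ = (1/κ) ∫₀¹ ρ(y) (∫₀^∞ e^{−y/(κv)} M_{T(y)}(v) dv) dy`. -/
noncomputable def Cminus (κ : ℝ) (ρ T : ℝ → ℝ) : ℝ :=
  κ⁻¹ * ∫ y in Icc (0 : ℝ) 1, ρ y * ∫ v in Ioi (0 : ℝ), Real.exp (-y / (κ * v)) * Mxw (T y) v

/-- `C₊ = (1/κ) ∫₀¹ ρ(y) (∫₀^∞ e^{−(1−y)/(κv)} M_{T(y)}(v) dv) dy`. -/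
noncomputable def Cplus (κ : ℝ) (ρ T : ℝ → ℝ) : ℝ :=
  κ⁻¹ * ∫ y in Icc (0 : ℝ) 1, ρ y * ∫ v in Ioi (0 : ℝ), Real.exp (-(1 - y) / (κ * v)) * Mxw (T y) v

/-- `f` is a mild steady state of the linear BGK equation with data `(κ, T₁, T₂, ρ, T)`. -/
def IsMildSteadyState (κ T₁ T₂ : ℝ) (ρ T : ℝ → ℝ) (f : ℝ → ℝ → ℝ) : Prop :=
  Cwall κ T₁ * Cwall κ T₂ < 1 ∧
  IntegrableOn
    (fun y => ρ y * ∫ v in Ioi (0 : ℝ), Real.exp (-y / (κ * v)) * Mxw (T y) v)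
    (Icc (0 : ℝ) 1) ∧
  IntegrableOn
    (fun y => ρ y * ∫ v in Ioi (0 : ℝ), Real.exp (-(1 - y) / (κ * v)) * Mxw (T y) v)
    (Icc (0 : ℝ) 1) ∧
  (∀ x ∈ Icc (0 : ℝ) 1, ρ x = ∫ v, f x v) ∧
  (∀ x ∈ Icc (0 : ℝ) 1,
    (∀ᵐ v ∂(volume.restrict (Ioi (0 : ℝ))),
      f x v = Real.exp (-x / (κ * v)) * wallMxw T₁ v *
          ((Cminus κ ρ T + Cwall κ T₂ * Cplus κ ρ T) / (1 - Cwall κ T₁ * Cwall κ T₂)) +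
        ∫ y in (0 : ℝ)..x, (κ * v)⁻¹ * Real.exp (-(x - y) / (κ * v)) * ρ y * Mxw (T y) v) ∧
    (∀ᵐ v ∂(volume.restrict (Iio (0 : ℝ))),
      f x v = Real.exp (-(1 - x) / (κ * |v|)) * wallMxw T₂ v *
          ((Cplus κ ρ T + Cwall κ T₁ * Cminus κ ρ T) / (1 - Cwall κ T₁ * Cwall κ T₂)) +
        ∫ y in x..1, (κ * |v|)⁻¹ * Real.exp (-(y - x) / (κ * |v|)) * ρ y * Mxw (T y) v))

lemma exp_neg_le_inv_sqrt {x : ℝ} (hx : 0 < x) : exp (-x) ≤ (√x)⁻¹ := by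
  have h0 : 0 < √x := Real.sqrt_pos.2 hx
  rw [exp_neg]
  apply inv_anti₀ h0
  nlinarith [Real.sq_sqrt hx.le, add_one_le_exp x, sq_nonneg (√x - 1)]

lemma mul_exp_neg_le_inv_sqrt {x : ℝ} (hx : 0 < x) : x * exp (-x) ≤ (√x)⁻¹ := by
  have h0 : 0 < √x := Real.sqrt_pos.2 hx
  have h1 := Real.quadratic_le_exp_of_nonneg hx.le
  have h2 := Real.sq_sqrt hx.le
  rw [exp_neg, ← div_eq_mul_inv, div_le_iff₀ (exp_pos x), ← div_eq_inv_mul, le_div_iff₀ h0]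
  have h3 : x * √x ≤ x / 2 + x ^ 2 / 2 := by nlinarith [sq_nonneg (√x - 1)]
  linarith

lemma mul_exp_neg_le_one (x : ℝ) : x * exp (-x) ≤ 1 := by
  rw [exp_neg, ← div_eq_mul_inv, div_le_one (exp_pos x)]
  linarith [add_one_le_exp x]

lemma one_sub_exp_neg_le_sqrt {x : ℝ} (hx : 0 ≤ x) : 1 - exp (-x) ≤ √x := by
  rcases le_total x 1 with h | h
  · have : x ≤ √x := Real.le_sqrt_of_sq_le (by nlinarith)
    linarith [add_one_le_exp (-x)]
  · have : 1 ≤ √x := Real.one_le_sqrt.2 h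
    linarith [exp_pos (-x)]

lemma inv_mul_exp_le {d v : ℝ} (hd : 0 < d) (hv : 0 < v) :
    v⁻¹ * exp (-d / v) ≤ (√d)⁻¹ * (√v)⁻¹ := by
  have h := exp_neg_le_inv_sqrt (div_pos hd hv)
  rw [Real.sqrt_div hd.le, ← neg_div] at h
  calc v⁻¹ * exp (-d / v) ≤ v⁻¹ * (√d / √v)⁻¹ := by gcongr
    _ = (√d)⁻¹ * (√v)⁻¹ := by
      have h1 : 0 < √v := Real.sqrt_pos.2 hv
      have h2 : 0 < √d := Real.sqrt_pos.2 hd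
      have h3 := Real.mul_self_sqrt hv.le
      field_simp
      nlinarith

lemma exp_sub_exp_le {d r s w : ℝ} (hr : 0 < r) (hrs : r ≤ s) (hw : 0 < w) :
    exp (-d / (s * w)) - exp (-d / (r * w)) ≤
      (s - r) / r * (d / (s * w) * exp (-(d / (s * w)))) := by
  have hs : 0 < s := hr.trans_le hrs
  have e : -d / (r * w) = -(d / (s * w)) + -((s - r) / r * (d / (s * w))) := by
    field_simp
    ring
  rw [e, exp_add, neg_div]
  have := add_one_le_exp (-((s - r) / r * (d / (s * w))))
  nlinarith [exp_pos (-(d / (s * w)))]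

lemma exp_le_exp_of_le {d r s w : ℝ} (hd : 0 ≤ d) (hr : 0 < r) (hrs : r ≤ s) (hw : 0 < w) :
    exp (-d / (r * w)) ≤ exp (-d / (s * w)) := by
  rw [neg_div, neg_div]
  gcongr

lemma abs_exp_sub_exp_le_of_le {d r s w : ℝ} (hd : 0 ≤ d) (hr : 0 < r) (hrs : r ≤ s) (hw : 0 < w) :
    |exp (-d / (s * w)) - exp (-d / (r * w))| ≤ (s - r) / r := by
  rw [abs_of_nonneg (sub_nonneg.2 (exp_le_exp_of_le hd hr hrs hw))]
  refine (exp_sub_exp_le hr hrs hw).trans ?_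
  have h := mul_exp_neg_le_one (d / (s * w))
  have : 0 ≤ (s - r) / r := div_nonneg (sub_nonneg.2 hrs) hr.le
  nlinarith

lemma abs_exp_sub_exp_le {d r s w : ℝ} (hd : 0 ≤ d) (hr : 1 ≤ r) (hs : 1 ≤ s) (hw : 0 < w) :
    |exp (-d / (s * w)) - exp (-d / (r * w))| ≤ |s - r| := by
  wlog hrs : r ≤ s generalizing r s
  · rw [abs_sub_comm, abs_sub_comm s r]
    exact this hs hr (le_of_not_ge hrs)
  rw [abs_of_nonneg (sub_nonneg.2 hrs)]
  exact (abs_exp_sub_exp_le_of_le hd (by linarith) hrs hw).trans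
    (div_le_self (sub_nonneg.2 hrs) hr)

lemma abs_mul_exp_sub_le {d r s w : ℝ} (hd : 0 ≤ d) (hr : 1 ≤ r) (hs : 1 ≤ s) (hw : 0 < w) :
    |s * w * exp (-d / (s * w)) - r * w * exp (-d / (r * w))| ≤ 2 * |s - r| * w := by
  wlog hrs : r ≤ s generalizing r s
  · rw [abs_sub_comm, abs_sub_comm s r]
    exact this hs hr (le_of_not_ge hrs)
  have hr0 : 0 < r := by linarith
  have h1 := abs_exp_sub_exp_le_of_le hd hr0 hrs hw
  rw [le_div_iff₀ hr0] at h1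
  have h2 : exp (-d / (s * w)) ≤ 1 := by
    rw [neg_div]
    exact exp_le_one_iff.2 (neg_nonpos.2 (by positivity))
  have h3 := exp_pos (-d / (s * w))
  rw [abs_of_nonneg (sub_nonneg.2 hrs)]
  have e : s * w * exp (-d / (s * w)) - r * w * exp (-d / (r * w)) =
      (s - r) * w * exp (-d / (s * w)) + w * ((exp (-d / (s * w)) - exp (-d / (r * w))) * r) := by
    ring
  have h4 : 0 ≤ (s - r) * w := mul_nonneg (sub_nonneg.2 hrs) hw.le
  rw [e]
  refine (abs_add_le _ _).trans ?_
  rw [abs_mul w, abs_mul _ r, abs_of_pos hw, abs_of_pos hr0, abs_of_nonneg (by positivity)]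
  nlinarith

lemma abs_inv_mul_exp_sub_le {d r s w : ℝ} (hd : 0 < d) (hr : 1 ≤ r) (hs : 1 ≤ s) (hw : 0 < w) :
    |(s * w)⁻¹ * exp (-d / (s * w)) - (r * w)⁻¹ * exp (-d / (r * w))| ≤
      2 * |s - r| * (√d)⁻¹ * (√w)⁻¹ := by
  wlog hrs : r ≤ s generalizing r s
  · rw [abs_sub_comm, abs_sub_comm s r]
    exact this hs hr (le_of_not_ge hrs)
  have hr0 : 0 < r := by linarith
  have hs0 : 0 < s := by linarith
  have hx : 0 < d / (s * w) := by positivity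
  have h1 := exp_neg_le_inv_sqrt hx
  have h2 := mul_exp_neg_le_inv_sqrt hx
  have h3 := exp_sub_exp_le (d := d) hr0 hrs hw
  have h4 := exp_le_exp_of_le hd.le hr0 hrs hw
  rw [abs_of_nonneg (sub_nonneg.2 hrs)]
  have hδ : 0 ≤ s - r := sub_nonneg.2 hrs
  have e : (s * w)⁻¹ * exp (-d / (s * w)) - (r * w)⁻¹ * exp (-d / (r * w)) =
      (s * w)⁻¹ * (exp (-d / (s * w)) - exp (-d / (r * w))) -
        (s - r) / (r * s * w) * exp (-d / (r * w)) := by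
    field_simp
    ring
  have h5 : (s * w)⁻¹ * (exp (-d / (s * w)) - exp (-d / (r * w))) ≤
      (s - r) / (r * s * w) * (√(d / (s * w)))⁻¹ := by
    calc _ ≤ (s * w)⁻¹ * ((s - r) / r * (√(d / (s * w)))⁻¹) := by
          gcongr
          exact h3.trans (by gcongr)
      _ = _ := by field_simp
  have h6 : (s - r) / (r * s * w) * exp (-d / (r * w)) ≤
      (s - r) / (r * s * w) * (√(d / (s * w)))⁻¹ := by
    gcongr
    refine h4.trans ?_
    rwa [neg_div]
  have h7 : (s - r) / (r * s * w) * (√(d / (s * w)))⁻¹ ≤ (s - r) * (√d)⁻¹ * (√w)⁻¹ := by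
    rw [Real.sqrt_div hd.le, Real.sqrt_mul hs0.le]
    have hw' : 0 < √w := Real.sqrt_pos.2 hw
    have hd' : 0 < √d := Real.sqrt_pos.2 hd
    have hs' : 1 ≤ √s := Real.one_le_sqrt.2 hs
    have e1 : (s - r) / (r * s * w) * (√d / (√s * √w))⁻¹ =
        (s - r) * (√d)⁻¹ * (√w)⁻¹ / (r * √s) := by
      rw [show r * s * w = r * (√s * √s) * (√w * √w) by
        rw [Real.mul_self_sqrt hs0.le, Real.mul_self_sqrt hw.le]]
      field_simp
    rw [e1]
    exact div_le_self (by positivity) (by nlinarith)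
  have h8 : 0 ≤ (s * w)⁻¹ * (exp (-d / (s * w)) - exp (-d / (r * w))) :=
    mul_nonneg (by positivity) (sub_nonneg.2 h4)
  have h9 : 0 ≤ (s - r) / (r * s * w) * exp (-d / (r * w)) := by positivity
  rw [e, abs_le]
  constructor <;> linarith

lemma Mxw_nonneg (T v : ℝ) : 0 ≤ Mxw T v := by
  unfold Mxw
  positivity

lemma measurable_Mxw : Measurable (fun z : ℝ × ℝ => Mxw z.1 z.2) := by
  unfold Mxw
  fun_prop

lemma Mxw_sq_mul {s : ℝ} (hs : 0 < s) (w : ℝ) : Mxw (s ^ 2) (s * w) = s⁻¹ * Mxw 1 w := by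
  unfold Mxw
  rw [Real.sqrt_mul (by positivity) (s ^ 2), Real.sqrt_sq hs.le, mul_one, mul_inv]
  rw [show -(s * w) ^ 2 / (2 * s ^ 2) = -w ^ 2 / (2 * 1) by field_simp]
  ring

lemma wallMxw_eq {T : ℝ} (hT : 0 < T) (v : ℝ) : wallMxw T v = √(2 * π) / √T * Mxw T v := by
  unfold wallMxw Mxw
  rw [Real.sqrt_mul (by positivity) T]
  have h1 : 0 < √T := Real.sqrt_pos.2 hT
  have h2 : 0 < √(2 * π) := Real.sqrt_pos.2 (by positivity)
  nth_rewrite 1 [← Real.mul_self_sqrt hT.le]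
  field_simp

lemma integral_mul_Mxw {T : ℝ} (hT : 0 < T) (F : ℝ → ℝ) :
    ∫ v in Ioi (0 : ℝ), F v * Mxw T v = ∫ w in Ioi (0 : ℝ), F (√T * w) * Mxw 1 w := by
  have h1 : 0 < √T := Real.sqrt_pos.2 hT
  have h := integral_comp_mul_left_Ioi' (fun v => F v * Mxw T v) 0 h1
  rw [mul_zero] at h
  rw [← h, smul_eq_mul, ← integral_const_mul]
  congr 1
  ext w
  nth_rewrite 3 [← Real.sq_sqrt hT.le]
  rw [Mxw_sq_mul h1]
  field_simp

lemma integrableOn_mul_Mxw {T : ℝ} (hT : 0 < T) {F : ℝ → ℝ}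
    (h : IntegrableOn (fun w => F (√T * w) * Mxw 1 w) (Ioi 0)) :
    IntegrableOn (fun v => F v * Mxw T v) (Ioi 0) := by
  have h1 : 0 < √T := Real.sqrt_pos.2 hT
  have h2 := (integrableOn_Ioi_comp_mul_left_iff (fun v => F v * Mxw T v) 0 h1).1
  rw [mul_zero] at h2
  refine h2 ?_
  refine (h.const_mul (√T)⁻¹).congr (Filter.Eventually.of_forall fun w => ?_)
  nth_rewrite 4 [← Real.sq_sqrt hT.le]
  simp only [Mxw_sq_mul h1]
  ring

lemma integrableOn_rpow_mul_Mxw_one {a : ℝ} (ha : -1 < a) :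
    IntegrableOn (fun w => w ^ a * Mxw 1 w) (Ioi 0) := by
  have h := (integrableOn_rpow_mul_exp_neg_mul_sq (b := 1 / 2) (by norm_num) ha).const_mul
    (√(2 * π * 1))⁻¹
  refine h.congr (Filter.Eventually.of_forall fun w => ?_)
  simp only [Mxw]
  rw [show -(1 / 2) * w ^ 2 = -w ^ 2 / (2 * 1) by ring]
  ring

lemma integrableOn_inv_sqrt_mul_Mxw_one :
    IntegrableOn (fun w => (√w)⁻¹ * Mxw 1 w) (Ioi 0) := by
  refine (integrableOn_rpow_mul_Mxw_one (a := -(1 / 2)) (by norm_num)).congr_fun ?_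
    measurableSet_Ioi
  intro w hw
  simp only
  rw [Real.rpow_neg (le_of_lt hw), Real.sqrt_eq_rpow]

lemma integrableOn_Mxw_one : IntegrableOn (fun w => 1 * Mxw 1 w) (Ioi 0) := by
  simpa using integrableOn_rpow_mul_Mxw_one (a := 0) (by norm_num)

lemma integrableOn_id_mul_Mxw_one : IntegrableOn (fun w => w * Mxw 1 w) (Ioi 0) := by
  simpa using integrableOn_rpow_mul_Mxw_one (a := 1) (by norm_num)

lemma integrableOn_sq_mul_Mxw_one : IntegrableOn (fun w => w ^ 2 * Mxw 1 w) (Ioi 0) := by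
  simpa using integrableOn_rpow_mul_Mxw_one (a := 2) (by norm_num)

lemma integral_Mxw_one : ∫ w in Ioi (0 : ℝ), 1 * Mxw 1 w = 1 / 2 := by
  have h := integral_gaussian_Ioi (1 / 2)
  have e : ∀ w, 1 * Mxw 1 w = (√(2 * π))⁻¹ * exp (-(1 / 2) * w ^ 2) := by
    intro w
    simp only [Mxw]
    rw [show -(1 / 2) * w ^ 2 = -w ^ 2 / (2 * 1) by ring]
    simp
  simp_rw [e]
  rw [integral_const_mul, h, show π / (1 / 2) = 2 * π by ring]
  have h2 : 0 < √(2 * π) := Real.sqrt_pos.2 (by positivity)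
  field_simp

lemma integral_id_mul_Mxw_one : ∫ w in Ioi (0 : ℝ), w * Mxw 1 w = (√(2 * π))⁻¹ := by
  have h := integral_rpow_mul_exp_neg_mul_rpow (p := 2) (q := 1) (b := 1 / 2)
    (by norm_num) (by norm_num) (by norm_num)
  have e : ∀ w, w * Mxw 1 w = (√(2 * π))⁻¹ * (w ^ (1 : ℝ) * exp (-(1 / 2) * w ^ (2 : ℝ))) := by
    intro w
    simp only [Mxw, rpow_one, rpow_two]
    rw [show -(1 / 2) * w ^ 2 = -w ^ 2 / (2 * 1) by ring, mul_one]
    ring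
  simp_rw [e]
  rw [integral_const_mul, h]
  norm_num

/-- `∫₀^∞ q(s w) e^{−d/(s w)} M₁(w) dw`, the half-line moment of the Maxwellian of
temperature `s²` with weight `q`, damped over the distance `d`. -/
noncomputable def halfMoment (q : ℝ → ℝ) (s d : ℝ) : ℝ :=
  ∫ w in Ioi (0 : ℝ), q (s * w) * exp (-d / (s * w)) * Mxw 1 w

section halfMoment

variable {q p : ℝ → ℝ} {s r d c : ℝ}

lemma integrableOn_halfMoment (hq : Measurable q)
    (hp : IntegrableOn (fun w => p w * Mxw 1 w) (Ioi 0))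
    (hb : ∀ w, 0 < w → |q (s * w) * exp (-d / (s * w))| ≤ c * p w) :
    IntegrableOn (fun w => q (s * w) * exp (-d / (s * w)) * Mxw 1 w) (Ioi 0) := by
  refine Integrable.mono' (hp.const_mul c) ?_ ?_
  · have : Measurable (fun w => Mxw 1 w) :=
      measurable_Mxw.comp (by fun_prop : Measurable fun w : ℝ => ((1 : ℝ), w))
    fun_prop
  · refine (ae_restrict_iff' measurableSet_Ioi).2 (Filter.Eventually.of_forall fun w hw => ?_)
    rw [norm_mul, Real.norm_of_nonneg (Mxw_nonneg 1 w), ← mul_assoc]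
    exact mul_le_mul_of_nonneg_right (hb w hw) (Mxw_nonneg 1 w)

lemma abs_halfMoment_le (hp : IntegrableOn (fun w => p w * Mxw 1 w) (Ioi 0))
    (hb : ∀ w, 0 < w → |q (s * w) * exp (-d / (s * w))| ≤ c * p w) :
    |halfMoment q s d| ≤ c * ∫ w in Ioi (0 : ℝ), p w * Mxw 1 w := by
  rw [← integral_const_mul]
  rw [← Real.norm_eq_abs]
  refine norm_integral_le_of_norm_le (hp.const_mul c) ?_
  refine (ae_restrict_iff' measurableSet_Ioi).2 (Filter.Eventually.of_forall fun w hw => ?_)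
  rw [norm_mul, Real.norm_of_nonneg (Mxw_nonneg 1 w), ← mul_assoc]
  exact mul_le_mul_of_nonneg_right (hb w hw) (Mxw_nonneg 1 w)

lemma abs_halfMoment_sub_le (hp : IntegrableOn (fun w => p w * Mxw 1 w) (Ioi 0))
    (hs : IntegrableOn (fun w => q (s * w) * exp (-d / (s * w)) * Mxw 1 w) (Ioi 0))
    (hr : IntegrableOn (fun w => q (r * w) * exp (-d / (r * w)) * Mxw 1 w) (Ioi 0))
    (hb : ∀ w, 0 < w →
      |q (s * w) * exp (-d / (s * w)) - q (r * w) * exp (-d / (r * w))| ≤ c * p w) :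
    |halfMoment q s d - halfMoment q r d| ≤ c * ∫ w in Ioi (0 : ℝ), p w * Mxw 1 w := by
  unfold halfMoment
  rw [← integral_const_mul, ← integral_sub hs hr]
  rw [← Real.norm_eq_abs]
  refine norm_integral_le_of_norm_le (hp.const_mul c) ?_
  refine (ae_restrict_iff' measurableSet_Ioi).2 (Filter.Eventually.of_forall fun w hw => ?_)
  rw [← sub_mul, norm_mul, Real.norm_of_nonneg (Mxw_nonneg 1 w), ← mul_assoc]
  exact mul_le_mul_of_nonneg_right (hb w hw) (Mxw_nonneg 1 w)

lemma halfMoment_nonneg (hs : 0 < s) (hq : ∀ v, 0 < v → 0 ≤ q v) : 0 ≤ halfMoment q s d := by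
  refine setIntegral_nonneg measurableSet_Ioi fun w hw => ?_
  exact mul_nonneg (mul_nonneg (hq _ (mul_pos hs hw)) (exp_pos _).le) (Mxw_nonneg 1 w)

lemma measurable_halfMoment (hq : Measurable q) :
    Measurable (fun z : ℝ × ℝ => halfMoment q z.1 z.2) := by
  have h : StronglyMeasurable (fun u : (ℝ × ℝ) × ℝ =>
      q (u.1.1 * u.2) * exp (-u.1.2 / (u.1.1 * u.2)) * Mxw 1 u.2) := by
    refine Measurable.stronglyMeasurable ?_
    have : Measurable (fun u : (ℝ × ℝ) × ℝ => Mxw 1 u.2) :=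
      measurable_Mxw.comp (by fun_prop : Measurable fun u : (ℝ × ℝ) × ℝ => ((1 : ℝ), u.2))
    fun_prop
  exact h.integral_prod_right.measurable

lemma exp_neg_div_le_one (hd : 0 ≤ d) (hs : 0 ≤ s) : exp (-d / s) ≤ 1 := by
  rw [neg_div]
  exact exp_le_one_iff.2 (neg_nonpos.2 (div_nonneg hd hs))

lemma abs_mul_exp_neg_div_le (hq : ∀ v, 0 < v → 0 ≤ q v) (hd : 0 ≤ d) (hs : 0 < s) :
    |q s * exp (-d / s)| ≤ q s := by
  rw [abs_of_nonneg (mul_nonneg (hq s hs) (exp_pos _).le)]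
  exact mul_le_of_le_one_right (hq s hs) (exp_neg_div_le_one hd hs.le)

lemma abs_inv_mul_exp_neg_div_le (hd : 0 < d) (hs : 0 < s) {w : ℝ} (hw : 0 < w) :
    |(s * w)⁻¹ * exp (-d / (s * w))| ≤ (√s)⁻¹ * (√d)⁻¹ * (√w)⁻¹ := by
  rw [abs_of_nonneg (by positivity)]
  refine (inv_mul_exp_le hd (mul_pos hs hw)).trans (le_of_eq ?_)
  rw [Real.sqrt_mul hs.le]
  ring

/-- The moment `∫₀^∞ w^{−1/2} M₁(w) dw`. -/
noncomputable def invSqrtMoment : ℝ := ∫ w in Ioi (0 : ℝ), (√w)⁻¹ * Mxw 1 w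

lemma invSqrtMoment_nonneg : 0 ≤ invSqrtMoment :=
  setIntegral_nonneg measurableSet_Ioi fun w _ => mul_nonneg (by positivity) (Mxw_nonneg 1 w)

lemma integrableOn_halfMoment_inv (hd : 0 < d) (hs : 0 < s) :
    IntegrableOn (fun w => (s * w)⁻¹ * exp (-d / (s * w)) * Mxw 1 w) (Ioi 0) :=
  integrableOn_halfMoment (q := fun v => v⁻¹) measurable_inv integrableOn_inv_sqrt_mul_Mxw_one
    fun _ hw => abs_inv_mul_exp_neg_div_le hd hs hw

lemma integrableOn_halfMoment_one (hd : 0 ≤ d) (hs : 0 < s) :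
    IntegrableOn (fun w => 1 * exp (-d / (s * w)) * Mxw 1 w) (Ioi 0) :=
  integrableOn_halfMoment (q := fun _ => 1) (c := 1) measurable_const integrableOn_Mxw_one
    fun w hw => (abs_mul_exp_neg_div_le (q := fun _ => 1) (fun _ _ => zero_le_one) hd
      (mul_pos hs hw)).trans (by simp)

lemma abs_id_mul_exp_le (hd : 0 ≤ d) (hs : 0 < s) {w : ℝ} (hw : 0 < w) :
    |s * w * exp (-d / (s * w))| ≤ s * w :=
  abs_mul_exp_neg_div_le (q := fun v => v) (fun _ h => h.le) hd (mul_pos hs hw)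

lemma abs_sq_mul_exp_le (hd : 0 ≤ d) (hs : 0 < s) {w : ℝ} (hw : 0 < w) :
    |(s * w) ^ 2 * exp (-d / (s * w))| ≤ s ^ 2 * w ^ 2 :=
  (abs_mul_exp_neg_div_le (q := fun v => v ^ 2) (fun _ h => by positivity) hd
    (mul_pos hs hw)).trans (le_of_eq (by ring))

lemma integrableOn_halfMoment_id (hd : 0 ≤ d) (hs : 0 < s) :
    IntegrableOn (fun w => s * w * exp (-d / (s * w)) * Mxw 1 w) (Ioi 0) :=
  integrableOn_halfMoment (q := fun v => v) measurable_id integrableOn_id_mul_Mxw_one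
    fun _ hw => abs_id_mul_exp_le hd hs hw

lemma integrableOn_halfMoment_sq (hd : 0 ≤ d) (hs : 0 < s) :
    IntegrableOn (fun w => (s * w) ^ 2 * exp (-d / (s * w)) * Mxw 1 w) (Ioi 0) :=
  integrableOn_halfMoment (q := fun v => v ^ 2) (by fun_prop) integrableOn_sq_mul_Mxw_one
    fun _ hw => abs_sq_mul_exp_le hd hs hw

lemma halfMoment_inv_le (hd : 0 < d) (hs : 0 < s) :
    |halfMoment (fun v => v⁻¹) s d| ≤ invSqrtMoment * (√s)⁻¹ * (√d)⁻¹ := by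
  refine (abs_halfMoment_le integrableOn_inv_sqrt_mul_Mxw_one
    fun _ hw => abs_inv_mul_exp_neg_div_le hd hs hw).trans (le_of_eq ?_)
  rw [invSqrtMoment]
  ring

lemma halfMoment_inv_sub_le (hd : 0 < d) (hr : 1 ≤ r) (hs : 1 ≤ s) :
    |halfMoment (fun v => v⁻¹) s d - halfMoment (fun v => v⁻¹) r d| ≤
      2 * invSqrtMoment * |s - r| * (√d)⁻¹ := by
  refine (abs_halfMoment_sub_le integrableOn_inv_sqrt_mul_Mxw_one
    (integrableOn_halfMoment_inv hd (by linarith)) (integrableOn_halfMoment_inv hd (by linarith))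
    fun _ hw => abs_inv_mul_exp_sub_le hd hr hs hw).trans (le_of_eq ?_)
  rw [invSqrtMoment]
  ring

lemma halfMoment_one_le (hd : 0 ≤ d) (hs : 0 < s) : halfMoment (fun _ => 1) s d ≤ 1 / 2 := by
  refine (le_abs_self _).trans ((abs_halfMoment_le (c := 1) integrableOn_Mxw_one
    fun w hw => (abs_mul_exp_neg_div_le (q := fun _ => 1) (fun _ _ => zero_le_one) hd
      (mul_pos hs hw)).trans (by simp)).trans ?_)
  rw [integral_Mxw_one, one_mul]

lemma halfMoment_one_sub_le (hd : 0 ≤ d) (hr : 1 ≤ r) (hs : 1 ≤ s) :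
    |halfMoment (fun _ => 1) s d - halfMoment (fun _ => 1) r d| ≤ |s - r| / 2 := by
  refine (abs_halfMoment_sub_le (c := |s - r|) integrableOn_Mxw_one
    (integrableOn_halfMoment_one hd (by linarith)) (integrableOn_halfMoment_one hd (by linarith))
    fun w hw => by simpa using abs_exp_sub_exp_le hd hr hs hw).trans ?_
  rw [integral_Mxw_one, mul_one_div]

lemma half_sub_halfMoment_one_le (hd : 0 ≤ d) (hd1 : d ≤ 1) (hs : 0 < s) :
    1 / 2 - halfMoment (fun _ => 1) s d ≤ invSqrtMoment * (√s)⁻¹ := by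
  rw [← integral_Mxw_one]
  unfold halfMoment
  rw [← integral_sub integrableOn_Mxw_one (integrableOn_halfMoment_one hd hs), invSqrtMoment,
    ← integral_mul_const]
  refine setIntegral_mono_on (integrableOn_Mxw_one.sub (integrableOn_halfMoment_one hd hs))
    (integrableOn_inv_sqrt_mul_Mxw_one.mul_const _) measurableSet_Ioi fun w hw => ?_
  have hw0 : 0 < w := hw
  have h1 := one_sub_exp_neg_le_sqrt (x := d / (s * w)) (by positivity)
  have h2 : √(d / (s * w)) ≤ (√w)⁻¹ * (√s)⁻¹ := by
    rw [Real.sqrt_div hd, Real.sqrt_mul hs.le, mul_comm (√s), div_eq_mul_inv, mul_inv]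
    exact mul_le_of_le_one_left (by positivity) (Real.sqrt_le_one.2 hd1)
  rw [← neg_div] at h1
  have := Mxw_nonneg 1 w
  nlinarith

lemma halfMoment_id_le (hd : 0 ≤ d) (hs : 0 < s) :
    |halfMoment (fun v => v) s d| ≤ s * (√(2 * π))⁻¹ := by
  rw [← integral_id_mul_Mxw_one]
  exact abs_halfMoment_le integrableOn_id_mul_Mxw_one fun _ hw => abs_id_mul_exp_le hd hs hw

lemma halfMoment_id_sub_le (hd : 0 ≤ d) (hr : 1 ≤ r) (hs : 1 ≤ s) :
    |halfMoment (fun v => v) s d - halfMoment (fun v => v) r d| ≤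
      2 * |s - r| * (√(2 * π))⁻¹ := by
  rw [← integral_id_mul_Mxw_one]
  exact abs_halfMoment_sub_le integrableOn_id_mul_Mxw_one
    (integrableOn_halfMoment_id hd (by linarith)) (integrableOn_halfMoment_id hd (by linarith))
    fun _ hw => abs_mul_exp_sub_le hd hr hs hw

lemma halfMoment_sq_le (hd : 0 ≤ d) (hs : 0 < s) :
    |halfMoment (fun v => v ^ 2) s d| ≤ s ^ 2 * ∫ w in Ioi (0 : ℝ), w ^ 2 * Mxw 1 w :=
  abs_halfMoment_le integrableOn_sq_mul_Mxw_one fun _ hw => abs_sq_mul_exp_le hd hs hw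

/-- The moment `∫₀^∞ w/(w+1) M₁(w) dw`. -/
noncomputable def fracMoment : ℝ := ∫ w in Ioi (0 : ℝ), w / (w + 1) * Mxw 1 w

lemma integrableOn_frac_mul_Mxw_one : IntegrableOn (fun w => w / (w + 1) * Mxw 1 w) (Ioi 0) := by
  refine Integrable.mono' integrableOn_id_mul_Mxw_one ?_ ?_
  · have : Measurable (fun w => Mxw 1 w) :=
      measurable_Mxw.comp (by fun_prop : Measurable fun w : ℝ => ((1 : ℝ), w))
    fun_prop
  · refine (ae_restrict_iff' measurableSet_Ioi).2 (Filter.Eventually.of_forall fun w hw => ?_)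
    have hw0 : 0 < w := hw
    rw [norm_mul, Real.norm_of_nonneg (Mxw_nonneg 1 w), Real.norm_of_nonneg (by positivity)]
    exact mul_le_mul_of_nonneg_right (div_le_self hw0.le (by linarith)) (Mxw_nonneg 1 w)

lemma fracMoment_pos : 0 < fracMoment := by
  have h : ∀ w ∈ Ioi (0 : ℝ), 0 < w / (w + 1) * Mxw 1 w := fun w hw => by
    have hw0 : 0 < w := hw
    unfold Mxw
    positivity
  refine (setIntegral_pos_iff_support_of_nonneg_ae ?_ integrableOn_frac_mul_Mxw_one).2 ?_
  · exact (ae_restrict_iff' measurableSet_Ioi).2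
      (Filter.Eventually.of_forall fun w hw => (h w hw).le)
  · have hsub : Ioi (0 : ℝ) ⊆ Function.support fun w => w / (w + 1) * Mxw 1 w :=
      fun w hw => (h w hw).ne'
    rw [inter_eq_self_of_subset_right hsub, Real.volume_Ioi]
    exact ENNReal.coe_lt_top

lemma fracMoment_le_sub_halfMoment_id (hs : 1 ≤ s) :
    fracMoment ≤ s * (√(2 * π))⁻¹ - halfMoment (fun v => v) s 1 := by
  have hs0 : 0 < s := by linarith
  rw [← integral_id_mul_Mxw_one, ← integral_const_mul]
  unfold halfMoment
  rw [← integral_sub (integrableOn_id_mul_Mxw_one.const_mul s)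
    (integrableOn_halfMoment_id zero_le_one hs0), fracMoment]
  refine setIntegral_mono_on integrableOn_frac_mul_Mxw_one
    ((integrableOn_id_mul_Mxw_one.const_mul s).sub
      (integrableOn_halfMoment_id zero_le_one hs0)) measurableSet_Ioi fun w hw => ?_
  have hw0 : 0 < w := hw
  have hsw : 0 < s * w := by positivity
  rw [← mul_assoc, ← sub_mul]
  refine mul_le_mul_of_nonneg_right ?_ (Mxw_nonneg 1 w)
  have h1 : exp (-1 / (s * w)) ≤ s * w / (s * w + 1) := by
    rw [neg_div, exp_neg, ← inv_div (s * w + 1)]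
    refine inv_anti₀ (by positivity) ?_
    rw [add_div, div_self hsw.ne', add_comm]
    exact add_one_le_exp _
  have h2 : w / (w + 1) ≤ s * w / (s * w + 1) := by
    rw [div_le_div_iff₀ (by positivity) (by positivity)]
    nlinarith
  have h3 : s * w * exp (-1 / (s * w)) ≤ s * w * (s * w / (s * w + 1)) := by gcongr
  have h4 : s * w - s * w * (s * w / (s * w + 1)) = s * w / (s * w + 1) := by
    field_simp
    ring
  linarith

end halfMoment

lemma integral_weight_mul_Mxw {T : ℝ} (hT : 0 < T) (q : ℝ → ℝ) (d : ℝ) :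
    ∫ v in Ioi (0 : ℝ), q v * exp (-d / v) * Mxw T v = halfMoment q (√T) d :=
  integral_mul_Mxw hT fun v => q v * exp (-d / v)

lemma halfLine_moment {q p ρ T g : ℝ → ℝ} {S : Set ℝ} {T₀ a d x : ℝ}
    (hq : Measurable q) (hq0 : ∀ v, 0 < v → 0 ≤ q v) (hqp : ∀ v, q v * v⁻¹ = p v)
    (hρ : Measurable ρ) (hT : Measurable T) (hTpos : ∀ y, 0 < T y) (hT₀ : 0 < T₀)
    (hS : MeasurableSet S) (hρ0 : ∀ y ∈ S, 0 ≤ ρ y)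
    (hwall : IntegrableOn (fun w => q (√T₀ * w) * exp (-d / (√T₀ * w)) * Mxw 1 w) (Ioi 0))
    (hker : ∀ᵐ y ∂(volume.restrict S), IntegrableOn
      (fun w => p (√(T y) * w) * exp (-|x - y| / (√(T y) * w)) * Mxw 1 w) (Ioi 0))
    (hI : IntegrableOn (fun y => ρ y * halfMoment p (√(T y)) |x - y|) S)
    (hg : ∀ᵐ v ∂(volume.restrict (Ioi (0 : ℝ))), g v = exp (-d / v) * wallMxw T₀ v * a +
      ∫ y in S, v⁻¹ * exp (-|x - y| / v) * ρ y * Mxw (T y) v) :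
    IntegrableOn (fun v => q v * g v) (Ioi 0) ∧
      ∫ v in Ioi (0 : ℝ), q v * g v = √(2 * π) / √T₀ * a * halfMoment q (√T₀) d +
        ∫ y in S, ρ y * halfMoment p (√(T y)) |x - y| := by
  have hp : Measurable p := by
    rw [← funext hqp]
    fun_prop
  set G : ℝ → ℝ → ℝ := fun v y => ρ y * (p v * exp (-|x - y| / v) * Mxw (T y) v) with hG
  have hint : ∀ y, ∫ v in Ioi (0 : ℝ), G v y = ρ y * halfMoment p (√(T y)) |x - y| := fun y => by
    rw [← integral_weight_mul_Mxw (hTpos y), ← integral_const_mul]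
  have hprod : Integrable (Function.uncurry G)
      ((volume.restrict (Ioi 0)).prod (volume.restrict S)) := by
    refine (integrable_prod_iff' ?_).2 ⟨?_, ?_⟩
    · have hM : Measurable (fun u : ℝ × ℝ => Mxw (T u.2) u.1) :=
        measurable_Mxw.comp (by fun_prop : Measurable fun u : ℝ × ℝ => (T u.2, u.1))
      refine Measurable.aestronglyMeasurable ?_
      simp only [hG, Function.uncurry_def]
      fun_prop
    · filter_upwards [hker] with y hy
      exact (integrableOn_mul_Mxw (hTpos y) (F := fun v => p v * exp (-|x - y| / v))
        hy).const_mul (ρ y)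
    · refine hI.congr ((ae_restrict_iff' hS).2 (Filter.Eventually.of_forall fun y hy => ?_))
      simp only
      rw [← hint y]
      refine setIntegral_congr_fun measurableSet_Ioi fun v hv => ?_
      have hv0 : 0 < v := hv
      have hp0 : 0 ≤ p v := by
        rw [← hqp]
        exact mul_nonneg (hq0 v hv0) (by positivity)
      exact (Real.norm_of_nonneg (mul_nonneg (hρ0 y hy) (mul_nonneg
        (mul_nonneg hp0 (exp_pos _).le) (Mxw_nonneg _ _)))).symm
  have hA : IntegrableOn (fun v => √(2 * π) / √T₀ * a * (q v * exp (-d / v) * Mxw T₀ v)) (Ioi 0) :=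
    (integrableOn_mul_Mxw hT₀ (F := fun v => q v * exp (-d / v)) hwall).const_mul _
  have hB : IntegrableOn (fun v => ∫ y in S, G v y) (Ioi 0) := hprod.integral_prod_left
  have heq : (fun v => q v * g v) =ᵐ[volume.restrict (Ioi 0)] fun v =>
      √(2 * π) / √T₀ * a * (q v * exp (-d / v) * Mxw T₀ v) + ∫ y in S, G v y := by
    filter_upwards [hg] with v hv
    rw [hv, wallMxw_eq hT₀, mul_add, ← integral_const_mul]
    congr 1
    · ring
    · congr 1
      ext y
      simp only [hG, ← hqp]
      ring
  refine ⟨(hA.add hB).congr heq.symm, ?_⟩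
  rw [integral_congr_ae heq, integral_add hA hB, integral_const_mul,
    integral_weight_mul_Mxw hT₀, integral_integral_swap hprod]
  simp_rw [hint]

lemma integral_eq_add_comp_neg {F : ℝ → ℝ} (h₁ : IntegrableOn F (Ioi 0))
    (h₂ : IntegrableOn (fun v => F (-v)) (Ioi 0)) :
    ∫ v, F v = (∫ v in Ioi (0 : ℝ), F v) + ∫ v in Ioi (0 : ℝ), F (-v) := by
  have h₃ : IntegrableOn F (Iic 0) := by
    have := (Measure.measurePreserving_neg (volume : Measure ℝ)).integrableOn_comp_preimage
      (Homeomorph.neg ℝ).measurableEmbedding (f := F) (s := Iio 0)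
    rw [integrableOn_Iic_iff_integrableOn_Iio, ← this]
    simpa [Function.comp_def] using h₂
  rw [integral_comp_neg_Ioi, neg_zero, add_comm, ← setIntegral_union (Iic_disjoint_Ioi le_rfl)
    measurableSet_Ioi h₃ h₁, Iic_union_Ioi, setIntegral_univ]

lemma ae_Ioi_comp_neg {P : ℝ → Prop} (h : ∀ᵐ v ∂(volume.restrict (Iio (0 : ℝ))), P v) :
    ∀ᵐ v ∂(volume.restrict (Ioi (0 : ℝ))), P (-v) := by
  have := ((Measure.measurePreserving_neg (volume : Measure ℝ)).restrict_preimage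
    (measurableSet_Iio (a := (0 : ℝ)))).quasiMeasurePreserving.ae h
  simpa using this

/-- A positive density of unit mass, with a temperature profile between `T₁` and `T₂`. -/
structure IsProfile (T₁ T₂ : ℝ) (ρ T : ℝ → ℝ) : Prop where
  measurable_density : Measurable ρ
  density_pos : ∀ y ∈ Icc (0 : ℝ) 1, 0 < ρ y
  bounded : ∃ B : ℝ, ∀ y ∈ Icc (0 : ℝ) 1, ρ y ≤ B
  mass : ∫ y in Icc (0 : ℝ) 1, ρ y = 1
  measurable_temp : Measurable T
  temp_pos : ∀ y, 0 < T y
  le_temp : ∀ y ∈ Icc (0 : ℝ) 1, T₁ ≤ T y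
  temp_le : ∀ y ∈ Icc (0 : ℝ) 1, T y ≤ T₂

/-- The coefficient of the wall Maxwellian at the wall of temperature `T₀`, in units of
`halfMoment`, for the outgoing fluxes `c` at this wall and `c'` at the opposite wall, the
latter being of temperature `T₀'`. -/
noncomputable def wallCoeff (T₀ T₀' c c' : ℝ) : ℝ :=
  √(2 * π) / √T₀ * ((c + Cwall 1 T₀' * c') / (1 - Cwall 1 T₀ * Cwall 1 T₀'))

lemma Cwall_eq {T₀ : ℝ} (hT₀ : 0 < T₀) :
    Cwall 1 T₀ = √(2 * π) / √T₀ * halfMoment (fun v => v) (√T₀) 1 := by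
  rw [← integral_weight_mul_Mxw hT₀, ← integral_const_mul, Cwall]
  congr 1
  ext v
  rw [wallMxw_eq hT₀, one_mul]
  ring

lemma ae_restrict_abs_sub_pos (x : ℝ) (S : Set ℝ) :
    ∀ᵐ y ∂(volume.restrict S), 0 < |x - y| := by
  refine ae_restrict_of_ae ?_
  filter_upwards [(countable_singleton x).ae_notMem volume] with y hy
  exact abs_pos.2 (sub_ne_zero.2 fun h => hy h.symm)

lemma integrableOn_inv_sqrt_abs_sub {x : ℝ} (hx : x ∈ Icc (0 : ℝ) 1) :
    IntegrableOn (fun y => (√|x - y|)⁻¹) (Icc 0 1) ∧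
      ∫ y in Icc (0 : ℝ) 1, (√|x - y|)⁻¹ ≤ 4 := by
  have key : ∀ z : ℝ, 0 ≤ z → IntervalIntegrable (fun t : ℝ => (√t)⁻¹) volume 0 z ∧
      ∫ t in (0 : ℝ)..z, (√t)⁻¹ = 2 * √z := by
    intro z hz
    have e : EqOn (fun t : ℝ => t ^ (-(1 / 2) : ℝ)) (fun t => (√t)⁻¹) (uIcc 0 z) := by
      intro t ht
      rw [uIcc_of_le hz] at ht
      simp only
      rw [Real.rpow_neg ht.1, Real.sqrt_eq_rpow]
    refine ⟨(intervalIntegral.intervalIntegrable_rpow' (by norm_num)).congr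
      (e.mono uIoc_subset_uIcc), ?_⟩
    rw [← intervalIntegral.integral_congr e, integral_rpow (Or.inl (by norm_num)),
      Real.sqrt_eq_rpow]
    norm_num
    ring
  obtain ⟨i1, v1⟩ := key x hx.1
  obtain ⟨i2, v2⟩ := key (1 - x) (by linarith [hx.2])
  have j1 : IntervalIntegrable (fun y => (√(x - y))⁻¹) volume 0 x := by
    simpa using (i1.comp_sub_left x).symm
  have w1 : ∫ y in (0 : ℝ)..x, (√(x - y))⁻¹ = 2 * √x := by
    rw [intervalIntegral.integral_comp_sub_left (fun t => (√t)⁻¹) x]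
    simpa using v1
  have j2 : IntervalIntegrable (fun y => (√(y - x))⁻¹) volume x 1 := by
    simpa using i2.comp_sub_right x
  have w2 : ∫ y in x..1, (√(y - x))⁻¹ = 2 * √(1 - x) := by
    rw [intervalIntegral.integral_comp_sub_right (fun t => (√t)⁻¹) x]
    simpa using v2
  have e1 : EqOn (fun y => (√(x - y))⁻¹) (fun y => (√|x - y|)⁻¹) (uIcc 0 x) := by
    intro y hy
    rw [uIcc_of_le hx.1] at hy
    simp only
    rw [abs_of_nonneg (sub_nonneg.2 hy.2)]
  have e2 : EqOn (fun y => (√(y - x))⁻¹) (fun y => (√|x - y|)⁻¹) (uIcc x 1) := by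
    intro y hy
    rw [uIcc_of_le hx.2] at hy
    simp only
    rw [abs_sub_comm, abs_of_nonneg (sub_nonneg.2 hy.1)]
  have k1 := j1.congr (e1.mono uIoc_subset_uIcc)
  have k2 := j2.congr (e2.mono uIoc_subset_uIcc)
  constructor
  · rw [integrableOn_Icc_iff_integrableOn_Ioc]
    exact (intervalIntegrable_iff_integrableOn_Ioc_of_le zero_le_one).1 (k1.trans k2)
  · rw [integral_Icc_eq_integral_Ioc, ← intervalIntegral.integral_of_le zero_le_one,
      ← intervalIntegral.integral_add_adjacent_intervals k1 k2,
      ← intervalIntegral.integral_congr e1, ← intervalIntegral.integral_congr e2, w1, w2]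
    have h1 : √x ≤ 1 := Real.sqrt_le_one.2 hx.2
    have h2 : √(1 - x) ≤ 1 := Real.sqrt_le_one.2 (by linarith [hx.1])
    linarith

lemma IsProfile.integrableOn_mul {T₁ T₂ : ℝ} {ρ T k β : ℝ → ℝ} (h : IsProfile T₁ T₂ ρ T)
    (hk : Measurable k) (hβ : IntegrableOn β (Icc 0 1))
    (hkβ : ∀ᵐ y ∂(volume.restrict (Icc (0 : ℝ) 1)), |k y| ≤ β y) :
    IntegrableOn (fun y => ρ y * k y) (Icc 0 1) := by
  obtain ⟨B, hB⟩ := h.bounded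
  refine Integrable.bdd_mul (c := B) (hβ.mono' hk.aestronglyMeasurable hkβ)
    h.measurable_density.aestronglyMeasurable ?_
  refine (ae_restrict_iff' measurableSet_Icc).2 (Filter.Eventually.of_forall fun y hy => ?_)
  rw [Real.norm_of_nonneg (h.density_pos y hy).le]
  exact hB y hy

lemma IsProfile.integrableOn_density {T₁ T₂ : ℝ} {ρ T : ℝ → ℝ} (h : IsProfile T₁ T₂ ρ T) :
    IntegrableOn ρ (Icc 0 1) := by
  simpa using h.integrableOn_mul (k := fun _ => 1) (β := fun _ => 1) measurable_const
    (integrableOn_const (by simp)) (by simp)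

lemma IsProfile.moment_eq {T₁ T₂ : ℝ} {ρ T q p : ℝ → ℝ} {f : ℝ → ℝ → ℝ}
    (h : IsProfile T₁ T₂ ρ T) (hT₁ : 0 < T₁) (hT₂ : 0 < T₂) (hf : IsMildSteadyState 1 T₁ T₂ ρ T f)
    (hq : Measurable q) (hq0 : ∀ v, 0 < v → 0 ≤ q v) (hqe : ∀ v, q (-v) = q v)
    (hqp : ∀ v, q v * v⁻¹ = p v)
    (hwall : ∀ s d, 0 < s → 0 ≤ d →
      IntegrableOn (fun w => q (s * w) * exp (-d / (s * w)) * Mxw 1 w) (Ioi 0))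
    (hker : ∀ s d, 0 < s → 0 < d →
      IntegrableOn (fun w => p (s * w) * exp (-d / (s * w)) * Mxw 1 w) (Ioi 0))
    {x : ℝ} (hx : x ∈ Icc (0 : ℝ) 1)
    (hI : IntegrableOn (fun y => ρ y * halfMoment p (√(T y)) |x - y|) (Icc 0 1)) :
    ∫ v, q v * f x v =
      wallCoeff T₁ T₂ (Cminus 1 ρ T) (Cplus 1 ρ T) * halfMoment q (√T₁) x +
      wallCoeff T₂ T₁ (Cplus 1 ρ T) (Cminus 1 ρ T) * halfMoment q (√T₂) (1 - x) +
      ∫ y in Icc (0 : ℝ) 1, ρ y * halfMoment p (√(T y)) |x - y| := by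
  obtain ⟨-, -, -, -, hfx⟩ := hf
  obtain ⟨hpos, hneg⟩ := hfx x hx
  have hx1 : 0 ≤ 1 - x := sub_nonneg.2 hx.2
  have sub1 : Ioc 0 x ⊆ Icc (0 : ℝ) 1 := fun y hy => ⟨hy.1.le, hy.2.trans hx.2⟩
  have sub2 : Ioc x 1 ⊆ Icc (0 : ℝ) 1 := fun y hy => ⟨hx.1.trans hy.1.le, hy.2⟩
  have hk : ∀ S : Set ℝ, ∀ᵐ y ∂(volume.restrict S), IntegrableOn
      (fun w => p (√(T y) * w) * exp (-|x - y| / (√(T y) * w)) * Mxw 1 w) (Ioi 0) := fun S => by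
    filter_upwards [ae_restrict_abs_sub_pos x S] with y hy
    exact hker _ _ (Real.sqrt_pos.2 (h.temp_pos y)) hy
  obtain ⟨i1, e1⟩ := halfLine_moment (g := f x) (S := Ioc 0 x) (T₀ := T₁) (d := x) (x := x)
    (a := (Cminus 1 ρ T + Cwall 1 T₂ * Cplus 1 ρ T) / (1 - Cwall 1 T₁ * Cwall 1 T₂))
    hq hq0 hqp h.measurable_density h.measurable_temp h.temp_pos hT₁ measurableSet_Ioc
    (fun y hy => (h.density_pos y (sub1 hy)).le) (hwall _ _ (Real.sqrt_pos.2 hT₁) hx.1)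
    (hk _) (hI.mono_set sub1) (by
      filter_upwards [hpos] with v hv
      rw [hv, intervalIntegral.integral_of_le hx.1, one_mul]
      congr 1
      refine setIntegral_congr_fun measurableSet_Ioc fun y hy => ?_
      rw [abs_of_nonneg (sub_nonneg.2 hy.2)])
  obtain ⟨i2, e2⟩ := halfLine_moment (g := fun v => f x (-v)) (S := Ioc x 1) (T₀ := T₂)
    (d := 1 - x) (x := x)
    (a := (Cplus 1 ρ T + Cwall 1 T₁ * Cminus 1 ρ T) / (1 - Cwall 1 T₂ * Cwall 1 T₁))
    hq hq0 hqp h.measurable_density h.measurable_temp h.temp_pos hT₂ measurableSet_Ioc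
    (fun y hy => (h.density_pos y (sub2 hy)).le) (hwall _ _ (Real.sqrt_pos.2 hT₂) hx1)
    (hk _) (hI.mono_set sub2) (by
      filter_upwards [ae_Ioi_comp_neg hneg, self_mem_ae_restrict measurableSet_Ioi] with v hv hv0
      have hv1 : |(-v)| = v := by rw [abs_neg, abs_of_pos hv0]
      have hw : wallMxw T₂ (-v) = wallMxw T₂ v := by simp [wallMxw]
      rw [hv, intervalIntegral.integral_of_le hx.2, one_mul, hv1, hw,
        mul_comm (Cwall 1 T₁) (Cwall 1 T₂)]
      congr 1
      refine setIntegral_congr_fun measurableSet_Ioc fun y hy => ?_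
      have hm : Mxw (T y) (-v) = Mxw (T y) v := by simp [Mxw]
      rw [abs_sub_comm, abs_of_nonneg (sub_nonneg.2 hy.1.le), hm])
  have i2' : IntegrableOn (fun v => q (-v) * f x (-v)) (Ioi 0) := by simpa only [hqe] using i2
  rw [integral_eq_add_comp_neg i1 i2', e1]
  simp only [hqe]
  rw [e2, integral_Icc_eq_integral_Ioc, ← Ioc_union_Ioc_eq_Ioc hx.1 hx.2,
    setIntegral_union (Ioc_disjoint_Ioc_of_le le_rfl) measurableSet_Ioc (hI.mono_set sub1)
      (hI.mono_set sub2), wallCoeff, wallCoeff]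
  ring

lemma abs_setIntegral_mul_sub_le {ρ ρ' k k' β : ℝ → ℝ} {N R α δ : ℝ}
    (hN : 0 ≤ N) (hR : 0 ≤ R)
    (h : IntegrableOn (fun y => ρ y * k y) (Icc 0 1))
    (h' : IntegrableOn (fun y => ρ' y * k' y) (Icc 0 1)) (hβ : IntegrableOn β (Icc 0 1))
    (hρ : ∀ y ∈ Icc (0 : ℝ) 1, |ρ y - ρ' y| ≤ N) (hρ' : ∀ y ∈ Icc (0 : ℝ) 1, |ρ' y| ≤ R)
    (hk : ∀ᵐ y ∂(volume.restrict (Icc (0 : ℝ) 1)), |k y| ≤ α * β y)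
    (hk' : ∀ᵐ y ∂(volume.restrict (Icc (0 : ℝ) 1)), |k y - k' y| ≤ δ * β y) :
    |(∫ y in Icc (0 : ℝ) 1, ρ y * k y) - ∫ y in Icc (0 : ℝ) 1, ρ' y * k' y| ≤
      (N * α + R * δ) * ∫ y in Icc (0 : ℝ) 1, β y := by
  rw [← integral_sub h h', ← integral_const_mul, ← Real.norm_eq_abs]
  refine norm_integral_le_of_norm_le (hβ.const_mul _) ?_
  filter_upwards [hk, hk', self_mem_ae_restrict measurableSet_Icc] with y h1 h2 hy
  rw [show ρ y * k y - ρ' y * k' y = (ρ y - ρ' y) * k y + ρ' y * (k y - k' y) by ring]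
  refine (abs_add_le _ _).trans ?_
  rw [abs_mul, abs_mul]
  have h3 := mul_le_mul (hρ y hy) h1 (abs_nonneg _) hN
  have h4 := mul_le_mul (hρ' y hy) h2 (abs_nonneg _) hR
  linarith

lemma le_two_mul_of_forall_le_half_add {S : Set ℝ} {u : ℝ → ℝ} {c M₀ : ℝ} (hS : S.Nonempty)
    (hM₀ : ∀ x ∈ S, u x ≤ M₀) (h : ∀ M, (∀ x ∈ S, u x ≤ M) → ∀ x ∈ S, u x ≤ M / 2 + c) :
    ∀ x ∈ S, u x ≤ 2 * c := by
  have hb : BddAbove (u '' S) := ⟨M₀, by rintro _ ⟨x, hx, rfl⟩; exact hM₀ x hx⟩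
  have h1 : ∀ x ∈ S, u x ≤ sSup (u '' S) := fun x hx => le_csSup hb ⟨x, hx, rfl⟩
  have h2 : sSup (u '' S) ≤ sSup (u '' S) / 2 + c := by
    refine csSup_le (hS.image u) ?_
    rintro _ ⟨x, hx, rfl⟩
    exact h _ h1 x hx
  intro x hx
  linarith [h1 x hx]

lemma Cwall_nonneg {T₀ : ℝ} (hT₀ : 1 ≤ T₀) : 0 ≤ Cwall 1 T₀ := by
  have h : 0 < √T₀ := Real.sqrt_pos.2 (by linarith)
  rw [Cwall_eq (by linarith)]
  exact mul_nonneg (by positivity) (halfMoment_nonneg h fun _ h => h.le)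

lemma fracMoment_le_one_sub_Cwall {T₀ : ℝ} (hT₀ : 1 ≤ T₀) :
    √(2 * π) / √T₀ * fracMoment ≤ 1 - Cwall 1 T₀ := by
  have h : 0 < √T₀ := Real.sqrt_pos.2 (by linarith)
  have h2 : 0 < √(2 * π) := Real.sqrt_pos.2 (by positivity)
  have h3 := fracMoment_le_sub_halfMoment_id (Real.one_le_sqrt.2 hT₀)
  calc _ ≤ √(2 * π) / √T₀ * (√T₀ * (√(2 * π))⁻¹ - halfMoment (fun v => v) (√T₀) 1) := by gcongr
    _ = 1 - Cwall 1 T₀ := by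
      rw [Cwall_eq (by linarith)]
      field_simp

lemma Cwall_le_one {T₀ : ℝ} (hT₀ : 1 ≤ T₀) : Cwall 1 T₀ ≤ 1 := by
  have := fracMoment_le_one_sub_Cwall hT₀
  have h := fracMoment_pos
  have : 0 ≤ √(2 * π) / √T₀ * fracMoment := by positivity
  linarith

section wallCoeff

variable {T₀ T₀' c c' e e' E : ℝ}

lemma fracMoment_le_one_sub_Cwall_mul (hT₀ : 1 ≤ T₀) (hT₀' : 1 ≤ T₀') :
    √(2 * π) / √T₀ * fracMoment ≤ 1 - Cwall 1 T₀ * Cwall 1 T₀' := by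
  refine (fracMoment_le_one_sub_Cwall hT₀).trans ?_
  nlinarith [Cwall_nonneg hT₀, Cwall_le_one hT₀']

lemma one_sub_Cwall_mul_pos (hT₀ : 1 ≤ T₀) (hT₀' : 1 ≤ T₀') :
    0 < 1 - Cwall 1 T₀ * Cwall 1 T₀' := by
  refine lt_of_lt_of_le ?_ (fracMoment_le_one_sub_Cwall_mul hT₀ hT₀')
  have h : 0 < √T₀ := Real.sqrt_pos.2 (by linarith)
  have h1 := fracMoment_pos
  positivity

lemma wallCoeff_sub : wallCoeff T₀ T₀' c c' - wallCoeff T₀ T₀' e e' =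
    wallCoeff T₀ T₀' (c - e) (c' - e') := by
  unfold wallCoeff
  ring

lemma abs_wallCoeff_le (hT₀ : 1 ≤ T₀) (hT₀' : 1 ≤ T₀') (hc : |c| ≤ E) (hc' : |c'| ≤ E) :
    |wallCoeff T₀ T₀' c c'| ≤ 2 * E / fracMoment := by
  have h := one_sub_Cwall_mul_pos hT₀ hT₀'
  have h1 := fracMoment_le_one_sub_Cwall_mul hT₀ hT₀'
  have h2 : 0 ≤ √(2 * π) / √T₀ := by positivity
  have h3 : |c + Cwall 1 T₀' * c'| ≤ 2 * E := by
    refine (abs_add_le _ _).trans ?_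
    rw [abs_mul, abs_of_nonneg (Cwall_nonneg hT₀')]
    have := mul_le_of_le_one_left (abs_nonneg c') (Cwall_le_one hT₀')
    linarith
  rw [wallCoeff, abs_mul, abs_div (c + _), abs_of_nonneg h2, abs_of_pos h, ← mul_div_assoc,
    div_le_div_iff₀ h fracMoment_pos]
  calc _ = √(2 * π) / √T₀ * fracMoment * |c + Cwall 1 T₀' * c'| := by ring
    _ ≤ (1 - Cwall 1 T₀ * Cwall 1 T₀') * (2 * E) := by gcongr
    _ = _ := by ring

lemma le_wallCoeff (hT₀ : 1 ≤ T₀) (hT₀' : 1 ≤ T₀') (hc : 0 ≤ c) (hc' : 0 ≤ c') :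
    √(2 * π) / √T₀ * c ≤ wallCoeff T₀ T₀' c c' := by
  have h := one_sub_Cwall_mul_pos hT₀ hT₀'
  have h1 := mul_nonneg (Cwall_nonneg hT₀) (Cwall_nonneg hT₀')
  have h2 := mul_nonneg (Cwall_nonneg hT₀') hc'
  unfold wallCoeff
  gcongr
  rw [le_div_iff₀ h]
  nlinarith

end wallCoeff

lemma Cminus_eq {ρ T : ℝ → ℝ} (hT : ∀ y, 0 < T y) :
    Cminus 1 ρ T = ∫ y in Icc (0 : ℝ) 1, ρ y * halfMoment (fun _ => 1) (√(T y)) y := by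
  rw [Cminus, inv_one, one_mul]
  congr 1
  ext y
  rw [← integral_weight_mul_Mxw (hT y)]
  simp only [one_mul]

lemma Cplus_eq {ρ T : ℝ → ℝ} (hT : ∀ y, 0 < T y) :
    Cplus 1 ρ T = ∫ y in Icc (0 : ℝ) 1, ρ y * halfMoment (fun _ => 1) (√(T y)) (1 - y) := by
  rw [Cplus, inv_one, one_mul]
  congr 1
  ext y
  rw [← integral_weight_mul_Mxw (hT y)]
  simp only [one_mul]

section profile

variable {T₁ T₂ : ℝ} {ρ ρ' T T' : ℝ → ℝ} {d : ℝ → ℝ} {f f' : ℝ → ℝ → ℝ} {N R D x : ℝ}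

lemma IsProfile.sqrt_le_sqrt_temp (h : IsProfile T₁ T₂ ρ T) {y : ℝ} (hy : y ∈ Icc (0 : ℝ) 1) :
    √T₁ ≤ √(T y) := Real.sqrt_le_sqrt (h.le_temp y hy)

lemma IsProfile.one_le_sqrt_temp (h : IsProfile T₁ T₂ ρ T) (hT₁ : 1 ≤ T₁) {y : ℝ}
    (hy : y ∈ Icc (0 : ℝ) 1) : 1 ≤ √(T y) :=
  (Real.one_le_sqrt.2 hT₁).trans (h.sqrt_le_sqrt_temp hy)

lemma IsProfile.measurable_kernel (h : IsProfile T₁ T₂ ρ T) (hd : Measurable d) {q : ℝ → ℝ}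
    (hq : Measurable q) : Measurable (fun y => halfMoment q (√(T y)) (d y)) := by
  have := h.measurable_temp
  exact (measurable_halfMoment hq).comp (by fun_prop : Measurable fun y => (√(T y), d y))

lemma inv_sqrt_sqrt_le (h : IsProfile T₁ T₂ ρ T) (hT₁ : 1 ≤ T₁) {y : ℝ}
    (hy : y ∈ Icc (0 : ℝ) 1) :
    invSqrtMoment * (√√(T y))⁻¹ ≤ invSqrtMoment * (√√T₁)⁻¹ := by
  have h1 : 0 < √√T₁ := Real.sqrt_pos.2 (Real.sqrt_pos.2 (by linarith))
  have := invSqrtMoment_nonneg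
  gcongr
  exact h.le_temp y hy

lemma IsProfile.kernel_one_mem (h : IsProfile T₁ T₂ ρ T) (hT₁ : 1 ≤ T₁)
    (hd : ∀ y ∈ Icc (0 : ℝ) 1, d y ∈ Icc (0 : ℝ) 1) {y : ℝ} (hy : y ∈ Icc (0 : ℝ) 1) :
    halfMoment (fun _ => 1) (√(T y)) (d y) ∈
      Icc (1 / 2 - invSqrtMoment * (√√T₁)⁻¹) (1 / 2) := by
  have hs : 0 < √(T y) := Real.sqrt_pos.2 (h.temp_pos y)
  refine ⟨?_, halfMoment_one_le (hd y hy).1 hs⟩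
  linarith [half_sub_halfMoment_one_le (hd y hy).1 (hd y hy).2 hs, inv_sqrt_sqrt_le h hT₁ hy]

lemma IsProfile.integrableOn_kernel_one (h : IsProfile T₁ T₂ ρ T) (hdm : Measurable d)
    (hd : ∀ y ∈ Icc (0 : ℝ) 1, d y ∈ Icc (0 : ℝ) 1) :
    IntegrableOn (fun y => ρ y * halfMoment (fun _ => 1) (√(T y)) (d y)) (Icc 0 1) := by
  refine h.integrableOn_mul (h.measurable_kernel hdm measurable_const)
    (integrableOn_const (C := (1 / 2 : ℝ)) (by simp)) ?_
  filter_upwards [self_mem_ae_restrict measurableSet_Icc] with y hy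
  have hs : 0 < √(T y) := Real.sqrt_pos.2 (h.temp_pos y)
  rw [abs_of_nonneg (halfMoment_nonneg hs fun _ _ => zero_le_one)]
  exact halfMoment_one_le (hd y hy).1 hs

lemma IsProfile.flux_mem (h : IsProfile T₁ T₂ ρ T) (hT₁ : 1 ≤ T₁) (hdm : Measurable d)
    (hd : ∀ y ∈ Icc (0 : ℝ) 1, d y ∈ Icc (0 : ℝ) 1) :
    ∫ y in Icc (0 : ℝ) 1, ρ y * halfMoment (fun _ => 1) (√(T y)) (d y) ∈
      Icc (1 / 2 - invSqrtMoment * (√√T₁)⁻¹) (1 / 2) := by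
  have e : ∀ c : ℝ, ∫ y in Icc (0 : ℝ) 1, ρ y * c = c := fun c => by
    rw [integral_mul_const, h.mass, one_mul]
  have hi := h.integrableOn_kernel_one hdm hd
  constructor
  · rw [← e (1 / 2 - _)]
    refine setIntegral_mono_on (h.integrableOn_density.mul_const _) hi measurableSet_Icc
      fun y hy => ?_
    exact mul_le_mul_of_nonneg_left (h.kernel_one_mem hT₁ hd hy).1 (h.density_pos y hy).le
  · refine (setIntegral_mono_on hi (h.integrableOn_density.mul_const (1 / 2)) measurableSet_Icc
      fun y hy => ?_).trans (e _).le
    exact mul_le_mul_of_nonneg_left (h.kernel_one_mem hT₁ hd hy).2 (h.density_pos y hy).le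

lemma IsProfile.abs_flux_sub_le (h : IsProfile T₁ T₂ ρ T) (h' : IsProfile T₁ T₂ ρ' T')
    (hT₁ : 1 ≤ T₁) (hdm : Measurable d) (hd : ∀ y ∈ Icc (0 : ℝ) 1, d y ∈ Icc (0 : ℝ) 1)
    (hN : ∀ y ∈ Icc (0 : ℝ) 1, |ρ y - ρ' y| ≤ N)
    (hD : ∀ y ∈ Icc (0 : ℝ) 1, |√(T y) - √(T' y)| ≤ D) :
    |(∫ y in Icc (0 : ℝ) 1, ρ y * halfMoment (fun _ => 1) (√(T y)) (d y)) -
      ∫ y in Icc (0 : ℝ) 1, ρ' y * halfMoment (fun _ => 1) (√(T' y)) (d y)| ≤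
      N * (invSqrtMoment * (√√T₁)⁻¹) + D / 2 := by
  have i1 := h.integrableOn_kernel_one hdm hd
  have i2 := h'.integrableOn_kernel_one hdm hd
  have i3 : IntegrableOn
      (fun y => (ρ y - ρ' y) * (halfMoment (fun _ => 1) (√(T y)) (d y) - 1 / 2)) (Icc 0 1) := by
    have hb : ∀ᵐ y ∂(volume.restrict (Icc (0 : ℝ) 1)),
        |halfMoment (fun _ => 1) (√(T y)) (d y) - 1 / 2| ≤ invSqrtMoment * (√√T₁)⁻¹ := by
      filter_upwards [self_mem_ae_restrict measurableSet_Icc] with y hy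
      have := h.kernel_one_mem hT₁ hd hy
      rw [abs_le]
      constructor <;> linarith [this.1, this.2]
    have hm := (h.measurable_kernel hdm (measurable_const (a := (1 : ℝ)))).sub_const (1 / 2)
    have hc : IntegrableOn (fun _ : ℝ => invSqrtMoment * (√√T₁)⁻¹) (Icc 0 1) :=
      integrableOn_const (by simp)
    simpa only [sub_mul, Pi.sub_def] using
      (h.integrableOn_mul hm hc hb).sub (h'.integrableOn_mul hm hc hb)
  have i4 : IntegrableOn (fun y => ρ' y * (halfMoment (fun _ => 1) (√(T y)) (d y) -
      halfMoment (fun _ => 1) (√(T' y)) (d y))) (Icc 0 1) := by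
    refine h'.integrableOn_mul (β := fun _ => D / 2)
      ((h.measurable_kernel hdm measurable_const).sub (h'.measurable_kernel hdm measurable_const))
      (integrableOn_const (by simp)) ?_
    filter_upwards [self_mem_ae_restrict measurableSet_Icc] with y hy
    have := halfMoment_one_sub_le (hd y hy).1 (h'.one_le_sqrt_temp hT₁ hy)
      (h.one_le_sqrt_temp hT₁ hy)
    linarith [hD y hy]
  have hmass : ∫ y in Icc (0 : ℝ) 1, (ρ y - ρ' y) * (1 / 2) = 0 := by
    rw [integral_mul_const, integral_sub h.integrableOn_density h'.integrableOn_density, h.mass,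
      h'.mass]
    simp
  have i5 : IntegrableOn (fun y => (ρ y - ρ' y) * (1 / 2)) (Icc 0 1) :=
    (h.integrableOn_density.sub h'.integrableOn_density).mul_const _
  have e : (∫ y in Icc (0 : ℝ) 1, ρ y * halfMoment (fun _ => 1) (√(T y)) (d y)) -
      ∫ y in Icc (0 : ℝ) 1, ρ' y * halfMoment (fun _ => 1) (√(T' y)) (d y) =
      (∫ y in Icc (0 : ℝ) 1, (ρ y - ρ' y) * (halfMoment (fun _ => 1) (√(T y)) (d y) - 1 / 2)) +
      ∫ y in Icc (0 : ℝ) 1, ρ' y * (halfMoment (fun _ => 1) (√(T y)) (d y) -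
        halfMoment (fun _ => 1) (√(T' y)) (d y)) := by
    have i6 : IntegrableOn (fun y =>
        (ρ y - ρ' y) * (halfMoment (fun _ => 1) (√(T y)) (d y) - 1 / 2) +
        ρ' y * (halfMoment (fun _ => 1) (√(T y)) (d y) -
          halfMoment (fun _ => 1) (√(T' y)) (d y))) (Icc 0 1) := i3.add i4
    have hz := integral_add i6 i5
    rw [hmass, add_zero] at hz
    rw [← integral_add i3 i4, ← integral_sub i1 i2, ← hz]
    congr 1
    ext y
    ring
  rw [e]
  refine (abs_add_le _ _).trans (add_le_add ?_ ?_)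
  · have hc : IntegrableOn (fun _ : ℝ => N * (invSqrtMoment * (√√T₁)⁻¹)) (Icc 0 1) :=
      integrableOn_const (by simp)
    rw [← Real.norm_eq_abs]
    refine (norm_integral_le_of_norm_le hc ?_).trans (le_of_eq (by simp))
    filter_upwards [self_mem_ae_restrict measurableSet_Icc] with y hy
    have hm := h.kernel_one_mem hT₁ hd hy
    rw [norm_mul]
    refine mul_le_mul (hN y hy) ?_ (norm_nonneg _) ((abs_nonneg _).trans (hN y hy))
    rw [Real.norm_eq_abs, abs_le]
    constructor <;> linarith [hm.1, hm.2]
  · rw [← Real.norm_eq_abs]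
    refine (norm_integral_le_of_norm_le (h'.integrableOn_density.mul_const (D / 2)) ?_).trans
      (le_of_eq ?_)
    · filter_upwards [self_mem_ae_restrict measurableSet_Icc] with y hy
      rw [norm_mul, Real.norm_of_nonneg (h'.density_pos y hy).le]
      refine mul_le_mul_of_nonneg_left ?_ (h'.density_pos y hy).le
      have := halfMoment_one_sub_le (hd y hy).1 (h'.one_le_sqrt_temp hT₁ hy)
        (h.one_le_sqrt_temp hT₁ hy)
      rw [Real.norm_eq_abs]
      linarith [hD y hy]
    · rw [integral_mul_const, h'.mass, one_mul]

lemma id_mem_Icc : ∀ y ∈ Icc (0 : ℝ) 1, y ∈ Icc (0 : ℝ) 1 := fun _ h => h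

lemma one_sub_mem_Icc : ∀ y ∈ Icc (0 : ℝ) 1, 1 - y ∈ Icc (0 : ℝ) 1 :=
  fun _ h => ⟨by linarith [h.2], by linarith [h.1]⟩

lemma IsProfile.Cminus_mem (h : IsProfile T₁ T₂ ρ T) (hT₁ : 1 ≤ T₁) :
    Cminus 1 ρ T ∈ Icc (1 / 2 - invSqrtMoment * (√√T₁)⁻¹) (1 / 2) := by
  rw [Cminus_eq h.temp_pos]
  exact h.flux_mem hT₁ measurable_id id_mem_Icc

lemma IsProfile.Cplus_mem (h : IsProfile T₁ T₂ ρ T) (hT₁ : 1 ≤ T₁) :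
    Cplus 1 ρ T ∈ Icc (1 / 2 - invSqrtMoment * (√√T₁)⁻¹) (1 / 2) := by
  rw [Cplus_eq h.temp_pos]
  exact h.flux_mem hT₁ (by fun_prop) one_sub_mem_Icc

lemma IsProfile.abs_Cminus_sub_le (h : IsProfile T₁ T₂ ρ T) (h' : IsProfile T₁ T₂ ρ' T')
    (hT₁ : 1 ≤ T₁) (hN : ∀ y ∈ Icc (0 : ℝ) 1, |ρ y - ρ' y| ≤ N)
    (hD : ∀ y ∈ Icc (0 : ℝ) 1, |√(T y) - √(T' y)| ≤ D) :
    |Cminus 1 ρ T - Cminus 1 ρ' T'| ≤ N * (invSqrtMoment * (√√T₁)⁻¹) + D / 2 := by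
  rw [Cminus_eq h.temp_pos, Cminus_eq h'.temp_pos]
  exact h.abs_flux_sub_le h' hT₁ measurable_id id_mem_Icc hN hD

lemma IsProfile.abs_Cplus_sub_le (h : IsProfile T₁ T₂ ρ T) (h' : IsProfile T₁ T₂ ρ' T')
    (hT₁ : 1 ≤ T₁) (hN : ∀ y ∈ Icc (0 : ℝ) 1, |ρ y - ρ' y| ≤ N)
    (hD : ∀ y ∈ Icc (0 : ℝ) 1, |√(T y) - √(T' y)| ≤ D) :
    |Cplus 1 ρ T - Cplus 1 ρ' T'| ≤ N * (invSqrtMoment * (√√T₁)⁻¹) + D / 2 := by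
  rw [Cplus_eq h.temp_pos, Cplus_eq h'.temp_pos]
  exact h.abs_flux_sub_le h' hT₁ (by fun_prop) one_sub_mem_Icc hN hD

lemma IsProfile.ae_abs_kernel_inv_le (h : IsProfile T₁ T₂ ρ T) (hT₁ : 1 ≤ T₁) :
    ∀ᵐ y ∂(volume.restrict (Icc (0 : ℝ) 1)), |halfMoment (fun v => v⁻¹) (√(T y)) (|x - y|)| ≤
      invSqrtMoment * (√√T₁)⁻¹ * (√|x - y|)⁻¹ := by
  filter_upwards [ae_restrict_abs_sub_pos x _, self_mem_ae_restrict measurableSet_Icc] with y h1 hy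
  refine (halfMoment_inv_le h1 (Real.sqrt_pos.2 (h.temp_pos y))).trans ?_
  have := inv_sqrt_sqrt_le h hT₁ hy
  gcongr ?_ * _

lemma IsProfile.integrableOn_kernel_inv (h : IsProfile T₁ T₂ ρ T) (hT₁ : 1 ≤ T₁)
    (hx : x ∈ Icc (0 : ℝ) 1) :
    IntegrableOn (fun y => ρ y * halfMoment (fun v => v⁻¹) (√(T y)) |x - y|) (Icc 0 1) :=
  h.integrableOn_mul (h.measurable_kernel (by fun_prop) measurable_inv)
    ((integrableOn_inv_sqrt_abs_sub hx).1.const_mul _) (h.ae_abs_kernel_inv_le hT₁)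

lemma IsProfile.ae_abs_kernel_id_le (h : IsProfile T₁ T₂ ρ T) :
    ∀ᵐ y ∂(volume.restrict (Icc (0 : ℝ) 1)), |halfMoment (fun v => v) (√(T y)) (|x - y|)| ≤
      √T₂ * (√(2 * π))⁻¹ := by
  filter_upwards [self_mem_ae_restrict measurableSet_Icc] with y hy
  refine (halfMoment_id_le (abs_nonneg _) (Real.sqrt_pos.2 (h.temp_pos y))).trans ?_
  have := Real.sqrt_le_sqrt (h.temp_le y hy)
  gcongr

lemma IsProfile.integrableOn_kernel_id (h : IsProfile T₁ T₂ ρ T) :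
    IntegrableOn (fun y => ρ y * halfMoment (fun v => v) (√(T y)) |x - y|) (Icc 0 1) :=
  h.integrableOn_mul (h.measurable_kernel (by fun_prop) measurable_id)
    (integrableOn_const (by simp)) h.ae_abs_kernel_id_le

lemma IsProfile.density_eq (h : IsProfile T₁ T₂ ρ T) (hT₁ : 1 ≤ T₁) (hT₂ : T₁ ≤ T₂)
    (hf : IsMildSteadyState 1 T₁ T₂ ρ T f) (hx : x ∈ Icc (0 : ℝ) 1) :
    ρ x = wallCoeff T₁ T₂ (Cminus 1 ρ T) (Cplus 1 ρ T) * halfMoment (fun _ => 1) (√T₁) x +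
      wallCoeff T₂ T₁ (Cplus 1 ρ T) (Cminus 1 ρ T) * halfMoment (fun _ => 1) (√T₂) (1 - x) +
      ∫ y in Icc (0 : ℝ) 1, ρ y * halfMoment (fun v => v⁻¹) (√(T y)) |x - y| := by
  have := h.moment_eq (q := fun _ => 1) (p := fun v => v⁻¹) (by linarith) (by linarith) hf
    measurable_const (fun _ _ => zero_le_one) (fun _ => rfl) (fun _ => one_mul _)
    (fun s d hs hd => integrableOn_halfMoment_one hd hs)
    (fun s d hs hd => integrableOn_halfMoment_inv hd hs) hx (h.integrableOn_kernel_inv hT₁ hx)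
  rw [← this, hf.2.2.2.1 x hx]
  simp only [one_mul]

lemma IsProfile.pressure_eq (h : IsProfile T₁ T₂ ρ T) (hT₁ : 1 ≤ T₁) (hT₂ : T₁ ≤ T₂)
    (hf : IsMildSteadyState 1 T₁ T₂ ρ T f) (hx : x ∈ Icc (0 : ℝ) 1) :
    ∫ v, v ^ 2 * f x v =
      wallCoeff T₁ T₂ (Cminus 1 ρ T) (Cplus 1 ρ T) * halfMoment (fun v => v ^ 2) (√T₁) x +
      wallCoeff T₂ T₁ (Cplus 1 ρ T) (Cminus 1 ρ T) * halfMoment (fun v => v ^ 2) (√T₂) (1 - x) +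
      ∫ y in Icc (0 : ℝ) 1, ρ y * halfMoment (fun v => v) (√(T y)) |x - y| :=
  h.moment_eq (q := fun v => v ^ 2) (p := fun v => v) (by linarith) (by linarith) hf
    (by fun_prop) (fun _ _ => by positivity) (fun _ => by ring)
    (fun v => by rcases eq_or_ne v 0 with rfl | hv <;> [simp; field_simp])
    (fun s d hs hd => integrableOn_halfMoment_sq hd hs)
    (fun s d hs hd => integrableOn_halfMoment_id hd.le hs) hx h.integrableOn_kernel_id

/-- The temperature `T₁` is large enough for the integral equation for the density to be a
contraction. -/
def IsHot (T₁ : ℝ) : Prop :=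
  1 ≤ T₁ ∧ invSqrtMoment * (√√T₁)⁻¹ * (2 / fracMoment + 4) ≤ 1 / 2

lemma IsHot.small (hT₁ : IsHot T₁) : invSqrtMoment * (√√T₁)⁻¹ ≤ 1 / 8 := by
  have h1 : 0 ≤ invSqrtMoment * (√√T₁)⁻¹ := mul_nonneg invSqrtMoment_nonneg (by positivity)
  have h2 : 0 < 2 / fracMoment := div_pos two_pos fracMoment_pos
  nlinarith [hT₁.2]

lemma exists_isHot : ∃ Θ : ℝ, 1 ≤ Θ ∧ ∀ T₁, Θ ≤ T₁ → IsHot T₁ := by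
  have hm := invSqrtMoment_nonneg
  have hc := fracMoment_pos
  set K : ℝ := 1 + 2 * (invSqrtMoment * (2 / fracMoment + 4)) with hK
  have hK0 : 0 ≤ invSqrtMoment * (2 / fracMoment + 4) := by positivity
  have hK1 : 1 ≤ K := by linarith
  refine ⟨K ^ 4, one_le_pow₀ hK1, fun T₁ hT₁ => ⟨(one_le_pow₀ hK1).trans hT₁, ?_⟩⟩
  have h1 : K ≤ √√T₁ := Real.le_sqrt_of_sq_le (Real.le_sqrt_of_sq_le (by
    rw [← pow_mul]
    exact hT₁))
  have h2 : 0 < √√T₁ := by linarith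
  rw [mul_right_comm, ← div_eq_mul_inv, div_le_iff₀ h2]
  linarith

lemma abs_mul_add_mul_le {a b k l A K : ℝ} (ha : |a| ≤ A) (hb : |b| ≤ A) (hk : |k| ≤ K)
    (hl : |l| ≤ K) : |a * k + b * l| ≤ 2 * A * K := by
  refine (abs_add_le _ _).trans ?_
  rw [abs_mul, abs_mul]
  have hA := (abs_nonneg _).trans ha
  have h1 := mul_le_mul ha hk (abs_nonneg _) hA
  have h2 := mul_le_mul hb hl (abs_nonneg _) hA
  linarith

lemma IsProfile.one_le_temp_right (h : IsProfile T₁ T₂ ρ T) (hT₁ : 1 ≤ T₁) : 1 ≤ T₂ :=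
  hT₁.trans ((h.le_temp 0 (by simp)).trans (h.temp_le 0 (by simp)))

lemma IsProfile.flux_bounds (h : IsProfile T₁ T₂ ρ T) (hT₁ : IsHot T₁) :
    (1 / 4 ≤ Cminus 1 ρ T ∧ |Cminus 1 ρ T| ≤ 1 / 2) ∧
      1 / 4 ≤ Cplus 1 ρ T ∧ |Cplus 1 ρ T| ≤ 1 / 2 := by
  have hs := hT₁.small
  obtain ⟨h1, h2⟩ := h.Cminus_mem hT₁.1
  obtain ⟨h3, h4⟩ := h.Cplus_mem hT₁.1
  refine ⟨⟨by linarith, abs_le.2 ⟨by linarith, h2⟩⟩, by linarith, abs_le.2 ⟨by linarith, h4⟩⟩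

lemma IsProfile.abs_wall_le (h : IsProfile T₁ T₂ ρ T) (hT₁ : IsHot T₁) {k l K : ℝ}
    (hk : |k| ≤ K) (hl : |l| ≤ K) :
    |wallCoeff T₁ T₂ (Cminus 1 ρ T) (Cplus 1 ρ T) * k +
      wallCoeff T₂ T₁ (Cplus 1 ρ T) (Cminus 1 ρ T) * l| ≤ 2 / fracMoment * K := by
  have hT₂ := h.one_le_temp_right hT₁.1
  obtain ⟨⟨-, h1⟩, -, h2⟩ := h.flux_bounds hT₁
  refine (abs_mul_add_mul_le (abs_wallCoeff_le hT₁.1 hT₂ h1 h2)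
    (abs_wallCoeff_le hT₂ hT₁.1 h2 h1) hk hl).trans (le_of_eq ?_)
  ring

lemma IsProfile.abs_wall_sub_le (h : IsProfile T₁ T₂ ρ T) (h' : IsProfile T₁ T₂ ρ' T')
    (hT₁ : 1 ≤ T₁) (hN : ∀ y ∈ Icc (0 : ℝ) 1, |ρ y - ρ' y| ≤ N)
    (hD : ∀ y ∈ Icc (0 : ℝ) 1, |√(T y) - √(T' y)| ≤ D) {k l K : ℝ}
    (hk : |k| ≤ K) (hl : |l| ≤ K) :
    |wallCoeff T₁ T₂ (Cminus 1 ρ T) (Cplus 1 ρ T) * k +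
        wallCoeff T₂ T₁ (Cplus 1 ρ T) (Cminus 1 ρ T) * l -
      (wallCoeff T₁ T₂ (Cminus 1 ρ' T') (Cplus 1 ρ' T') * k +
        wallCoeff T₂ T₁ (Cplus 1 ρ' T') (Cminus 1 ρ' T') * l)| ≤
      4 / fracMoment * (N * (invSqrtMoment * (√√T₁)⁻¹) + D / 2) * K := by
  have hT₂ := h.one_le_temp_right hT₁
  have h1 := h.abs_Cminus_sub_le h' hT₁ hN hD
  have h2 := h.abs_Cplus_sub_le h' hT₁ hN hD
  rw [add_sub_add_comm, ← sub_mul, ← sub_mul, wallCoeff_sub, wallCoeff_sub]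
  refine (abs_mul_add_mul_le (abs_wallCoeff_le hT₁ hT₂ h1 h2)
    (abs_wallCoeff_le hT₂ hT₁ h2 h1) hk hl).trans (le_of_eq ?_)
  ring

lemma abs_halfMoment_one_le {s d : ℝ} (hd : 0 ≤ d) (hs : 1 ≤ s) :
    |halfMoment (fun _ => 1) s d| ≤ 1 / 2 := by
  have hs0 : 0 < s := by linarith
  rw [abs_of_nonneg (halfMoment_nonneg hs0 fun _ _ => zero_le_one)]
  exact halfMoment_one_le hd hs0

lemma IsProfile.density_le (h : IsProfile T₁ T₂ ρ T) (hT₁ : IsHot T₁)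
    (hf : IsMildSteadyState 1 T₁ T₂ ρ T f) :
    ∀ x ∈ Icc (0 : ℝ) 1, ρ x ≤ 2 / fracMoment := by
  have hT₂ := h.one_le_temp_right hT₁.1
  have hT₁₂ : T₁ ≤ T₂ := (h.le_temp 0 (by simp)).trans (h.temp_le 0 (by simp))
  have hε : 0 ≤ invSqrtMoment * (√√T₁)⁻¹ := mul_nonneg invSqrtMoment_nonneg (by positivity)
  obtain ⟨B, hB⟩ := h.bounded
  have key := le_two_mul_of_forall_le_half_add (c := 1 / fracMoment) ⟨0, by simp⟩ hB ?_
  · intro x hx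
    exact (key x hx).trans (le_of_eq (by ring))
  intro M hM x hx
  have hM0 : 0 ≤ M := (h.density_pos x hx).le.trans (hM x hx)
  obtain ⟨i, hi⟩ := integrableOn_inv_sqrt_abs_sub hx
  have h1 := h.abs_wall_le hT₁
    (abs_halfMoment_one_le hx.1 (Real.one_le_sqrt.2 hT₁.1))
    (abs_halfMoment_one_le (sub_nonneg.2 hx.2) (Real.one_le_sqrt.2 hT₂))
  have h2 := abs_setIntegral_mul_sub_le (ρ' := fun _ => 0) (R := 0) (δ := 0)
    (k' := fun y => halfMoment (fun v => v⁻¹) (√(T y)) |x - y|) hM0 le_rfl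
    (h.integrableOn_kernel_inv hT₁.1 hx) (by simp [IntegrableOn]) i
    (fun y hy => by simpa [abs_of_pos (h.density_pos y hy)] using hM y hy) (by simp)
    (h.ae_abs_kernel_inv_le hT₁.1) (by simp)
  simp only [zero_mul, integral_zero, sub_zero, add_zero] at h2
  have h3 : M * (invSqrtMoment * (√√T₁)⁻¹) * ∫ y in Icc (0 : ℝ) 1, (√|x - y|)⁻¹ ≤
      M * (1 / 8) * 4 := by
    have := hT₁.small
    gcongr
  rw [h.density_eq hT₁.1 hT₁₂ hf hx]
  have h4 := (le_abs_self _).trans h1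
  have h5 := (le_abs_self _).trans h2
  have h6 : 2 / fracMoment * (1 / 2) = 1 / fracMoment := by ring
  linarith

lemma IsProfile.le_density (h : IsProfile T₁ T₂ ρ T) (hT₁ : IsHot T₁)
    (hf : IsMildSteadyState 1 T₁ T₂ ρ T f) (hx : x ∈ Icc (0 : ℝ) 1) :
    √(2 * π) / √T₁ / 16 ≤ ρ x := by
  have hT₂ := h.one_le_temp_right hT₁.1
  have hT₁₂ : T₁ ≤ T₂ := (h.le_temp 0 (by simp)).trans (h.temp_le 0 (by simp))
  obtain ⟨⟨h1, -⟩, h2, -⟩ := h.flux_bounds hT₁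
  have hs₁ : 0 < √T₁ := Real.sqrt_pos.2 (by linarith [hT₁.1])
  have hs₂ : 0 < √T₂ := Real.sqrt_pos.2 (by linarith)
  have hw := le_wallCoeff hT₁.1 hT₂ (c := Cminus 1 ρ T) (c' := Cplus 1 ρ T) (by linarith)
    (by linarith)
  have hw' := le_wallCoeff hT₂ hT₁.1 (c := Cplus 1 ρ T) (c' := Cminus 1 ρ T) (by linarith)
    (by linarith)
  have hk := half_sub_halfMoment_one_le hx.1 hx.2 hs₁
  have hsm := hT₁.small
  have h3 : 0 ≤ wallCoeff T₂ T₁ (Cplus 1 ρ T) (Cminus 1 ρ T) *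
      halfMoment (fun _ => 1) (√T₂) (1 - x) :=
    mul_nonneg (le_trans (by positivity) hw') (halfMoment_nonneg hs₂ fun _ _ => zero_le_one)
  have h4 : 0 ≤ ∫ y in Icc (0 : ℝ) 1, ρ y * halfMoment (fun v => v⁻¹) (√(T y)) |x - y| :=
    setIntegral_nonneg measurableSet_Icc fun y hy => mul_nonneg (h.density_pos y hy).le
      (halfMoment_nonneg (Real.sqrt_pos.2 (h.temp_pos y)) fun _ hv => (inv_pos.2 hv).le)
  rw [h.density_eq hT₁.1 hT₁₂ hf hx]
  calc _ = √(2 * π) / √T₁ * (1 / 4) * (1 / 4) := by ring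
    _ ≤ wallCoeff T₁ T₂ (Cminus 1 ρ T) (Cplus 1 ρ T) * halfMoment (fun _ => 1) (√T₁) x := by
      have : √(2 * π) / √T₁ * (1 / 4) ≤ √(2 * π) / √T₁ * Cminus 1 ρ T := by gcongr
      exact mul_le_mul (this.trans hw) (by linarith) (by norm_num)
        (le_trans (by positivity) hw)
    _ ≤ _ := by linarith

lemma IsProfile.abs_density_le (h : IsProfile T₁ T₂ ρ T) (hT₁ : IsHot T₁)
    (hf : IsMildSteadyState 1 T₁ T₂ ρ T f) :
    ∀ x ∈ Icc (0 : ℝ) 1, |ρ x| ≤ 2 / fracMoment := fun x hx => by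
  rw [abs_of_pos (h.density_pos x hx)]
  exact h.density_le hT₁ hf x hx

/-- The Lipschitz constant of the density with respect to the root of the temperature. -/
noncomputable def densityConst : ℝ :=
  2 * (1 / fracMoment + 16 * invSqrtMoment / fracMoment)

lemma densityConst_pos : 0 < densityConst := by
  have := fracMoment_pos
  have := invSqrtMoment_nonneg
  unfold densityConst
  positivity

lemma IsProfile.abs_density_sub_le (h : IsProfile T₁ T₂ ρ T) (h' : IsProfile T₁ T₂ ρ' T')
    (hT₁ : IsHot T₁) (hf : IsMildSteadyState 1 T₁ T₂ ρ T f)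
    (hf' : IsMildSteadyState 1 T₁ T₂ ρ' T' f')
    (hD : ∀ y ∈ Icc (0 : ℝ) 1, |√(T y) - √(T' y)| ≤ D) :
    ∀ x ∈ Icc (0 : ℝ) 1, |ρ x - ρ' x| ≤ densityConst * D := by
  have hT₂ := h.one_le_temp_right hT₁.1
  have hT₁₂ : T₁ ≤ T₂ := (h.le_temp 0 (by simp)).trans (h.temp_le 0 (by simp))
  have hε : 0 ≤ invSqrtMoment * (√√T₁)⁻¹ := mul_nonneg invSqrtMoment_nonneg (by positivity)
  have hm := invSqrtMoment_nonneg
  have hc := fracMoment_pos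
  have hD0 : 0 ≤ D := (abs_nonneg _).trans (hD 0 (by simp))
  have key := le_two_mul_of_forall_le_half_add (u := fun x => |ρ x - ρ' x|)
    (c := densityConst / 2 * D) (M₀ := 2 / fracMoment + 2 / fracMoment) ⟨0, by simp⟩
    (fun x hx => (abs_sub _ _).trans (add_le_add (h.abs_density_le hT₁ hf x hx)
      (h'.abs_density_le hT₁ hf' x hx))) ?_
  · intro x hx
    exact (key x hx).trans (le_of_eq (by ring))
  intro N hN x hx
  have hN0 : 0 ≤ N := (abs_nonneg _).trans (hN x hx)
  obtain ⟨i, hi⟩ := integrableOn_inv_sqrt_abs_sub hx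
  have h1 := h.abs_wall_sub_le h' hT₁.1 hN hD
    (abs_halfMoment_one_le hx.1 (Real.one_le_sqrt.2 hT₁.1))
    (abs_halfMoment_one_le (sub_nonneg.2 hx.2) (Real.one_le_sqrt.2 hT₂))
  have h2 := abs_setIntegral_mul_sub_le (R := 2 / fracMoment) (δ := 2 * invSqrtMoment * D)
    hN0 (by positivity) (h.integrableOn_kernel_inv hT₁.1 hx)
    (h'.integrableOn_kernel_inv hT₁.1 hx) i hN (h'.abs_density_le hT₁ hf')
    (h.ae_abs_kernel_inv_le hT₁.1) (by
      filter_upwards [ae_restrict_abs_sub_pos x _, self_mem_ae_restrict measurableSet_Icc]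
        with y hxy hy
      refine (halfMoment_inv_sub_le hxy (h'.one_le_sqrt_temp hT₁.1 hy)
        (h.one_le_sqrt_temp hT₁.1 hy)).trans ?_
      have := hD y hy
      gcongr)
  have h3 : (N * (invSqrtMoment * (√√T₁)⁻¹) + 2 / fracMoment * (2 * invSqrtMoment * D)) *
      ∫ y in Icc (0 : ℝ) 1, (√|x - y|)⁻¹ ≤
      (N * (invSqrtMoment * (√√T₁)⁻¹) + 2 / fracMoment * (2 * invSqrtMoment * D)) * 4 := by
    gcongr
  have h4 := mul_le_mul_of_nonneg_left hT₁.2 hN0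
  rw [h.density_eq hT₁.1 hT₁₂ hf hx, h'.density_eq hT₁.1 hT₁₂ hf' hx, add_sub_add_comm]
  refine (abs_add_le _ _).trans ((add_le_add h1 (h2.trans h3)).trans ?_)
  calc _ = N * (invSqrtMoment * (√√T₁)⁻¹ * (2 / fracMoment + 4)) + densityConst / 2 * D := by
        unfold densityConst
        ring
    _ ≤ _ := by linarith

/-- A bound for the second half-line moment of the Maxwellians of temperature at most `T₂`. -/
noncomputable def sqBound (T₂ : ℝ) : ℝ := T₂ * ∫ w in Ioi (0 : ℝ), w ^ 2 * Mxw 1 w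

lemma sqBound_nonneg (hT₂ : 0 ≤ T₂) : 0 ≤ sqBound T₂ :=
  mul_nonneg hT₂ (setIntegral_nonneg measurableSet_Ioi fun w _ =>
    mul_nonneg (sq_nonneg w) (Mxw_nonneg 1 w))

lemma abs_halfMoment_sq_le {T₀ d : ℝ} (hT₀ : 0 < T₀) (hT₂ : T₀ ≤ T₂) (hd : 0 ≤ d) :
    |halfMoment (fun v => v ^ 2) (√T₀) d| ≤ sqBound T₂ := by
  have h := halfMoment_sq_le hd (Real.sqrt_pos.2 hT₀)
  rw [Real.sq_sqrt hT₀.le] at h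
  refine h.trans (mul_le_mul_of_nonneg_right hT₂ ?_)
  exact setIntegral_nonneg measurableSet_Ioi fun w _ =>
    mul_nonneg (sq_nonneg w) (Mxw_nonneg 1 w)

/-- A bound for the pressure. -/
noncomputable def pressureBound (T₂ : ℝ) : ℝ :=
  2 / fracMoment * sqBound T₂ + 2 / fracMoment * (√T₂ * (√(2 * π))⁻¹)

/-- The Lipschitz constant of the pressure with respect to the root of the temperature. -/
noncomputable def pressureConst (T₂ : ℝ) : ℝ :=
  4 / fracMoment * (densityConst + 1) * sqBound T₂ +
    (densityConst * (√T₂ * (√(2 * π))⁻¹) + 2 / fracMoment * (2 * (√(2 * π))⁻¹))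

lemma IsProfile.abs_pressure_le (h : IsProfile T₁ T₂ ρ T) (hT₁ : IsHot T₁)
    (hf : IsMildSteadyState 1 T₁ T₂ ρ T f) (hx : x ∈ Icc (0 : ℝ) 1) :
    |∫ v, v ^ 2 * f x v| ≤ pressureBound T₂ := by
  have hT₂ := h.one_le_temp_right hT₁.1
  have hT₁₂ : T₁ ≤ T₂ := (h.le_temp 0 (by simp)).trans (h.temp_le 0 (by simp))
  have hc := fracMoment_pos
  have h1 := h.abs_wall_le hT₁
    (abs_halfMoment_sq_le (by linarith [hT₁.1]) hT₁₂ hx.1)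
    (abs_halfMoment_sq_le (by linarith) le_rfl (sub_nonneg.2 hx.2))
  have h2 := abs_setIntegral_mul_sub_le (ρ' := fun _ => 0) (R := 0) (δ := 0) (β := fun _ => 1)
    (k' := fun y => halfMoment (fun v => v) (√(T y)) |x - y|)
    (div_pos two_pos hc).le le_rfl h.integrableOn_kernel_id (by simp [IntegrableOn])
    (integrableOn_const (by simp)) (fun y hy => by simpa using h.abs_density_le hT₁ hf y hy)
    (by simp) (by simpa using h.ae_abs_kernel_id_le (x := x)) (by simp)
  simp only [zero_mul, integral_zero, sub_zero, add_zero] at h2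
  rw [h.pressure_eq hT₁.1 hT₁₂ hf hx]
  refine (abs_add_le _ _).trans (add_le_add h1 (h2.trans (le_of_eq ?_)))
  simp

lemma IsProfile.abs_pressure_sub_le (h : IsProfile T₁ T₂ ρ T) (h' : IsProfile T₁ T₂ ρ' T')
    (hT₁ : IsHot T₁) (hf : IsMildSteadyState 1 T₁ T₂ ρ T f)
    (hf' : IsMildSteadyState 1 T₁ T₂ ρ' T' f')
    (hD : ∀ y ∈ Icc (0 : ℝ) 1, |√(T y) - √(T' y)| ≤ D) (hx : x ∈ Icc (0 : ℝ) 1) :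
    |(∫ v, v ^ 2 * f x v) - ∫ v, v ^ 2 * f' x v| ≤ pressureConst T₂ * D := by
  have hT₂ := h.one_le_temp_right hT₁.1
  have hT₁₂ : T₁ ≤ T₂ := (h.le_temp 0 (by simp)).trans (h.temp_le 0 (by simp))
  have hm := invSqrtMoment_nonneg
  have hc := fracMoment_pos
  have hdc := densityConst_pos
  have hD0 : 0 ≤ D := (abs_nonneg _).trans (hD 0 (by simp))
  have hN := h.abs_density_sub_le h' hT₁ hf hf' hD
  have h1 := h.abs_wall_sub_le h' hT₁.1 hN hD
    (abs_halfMoment_sq_le (by linarith [hT₁.1]) hT₁₂ hx.1)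
    (abs_halfMoment_sq_le (by linarith) le_rfl (sub_nonneg.2 hx.2))
  have h2 := abs_setIntegral_mul_sub_le (R := 2 / fracMoment) (δ := 2 * D * (√(2 * π))⁻¹)
    (β := fun _ => 1) (by positivity) (by positivity) (h.integrableOn_kernel_id (x := x))
    (h'.integrableOn_kernel_id (x := x)) (integrableOn_const (by simp)) hN
    (h'.abs_density_le hT₁ hf') (by simpa only [mul_one] using h.ae_abs_kernel_id_le (x := x)) (by
      filter_upwards [self_mem_ae_restrict measurableSet_Icc] with y hy
      refine (halfMoment_id_sub_le (abs_nonneg _) (h'.one_le_sqrt_temp hT₁.1 hy)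
        (h.one_le_sqrt_temp hT₁.1 hy)).trans ?_
      have := hD y hy
      rw [mul_one]
      gcongr)
  have h3 : 4 / fracMoment * (densityConst * D * (invSqrtMoment * (√√T₁)⁻¹) + D / 2) *
      sqBound T₂ ≤ 4 / fracMoment * (densityConst * D * 1 + D) * sqBound T₂ := by
    have := hT₁.small
    have := sqBound_nonneg (T₂ := T₂) (by linarith)
    gcongr
    · linarith
    · linarith
  rw [h.pressure_eq hT₁.1 hT₁₂ hf hx, h'.pressure_eq hT₁.1 hT₁₂ hf' hx, add_sub_add_comm]
  refine (abs_add_le _ _).trans ((add_le_add (h1.trans h3) h2).trans (le_of_eq ?_))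
  simp only [integral_const, MeasurableSet.univ, measureReal_restrict_apply, univ_inter,
    Real.volume_real_Icc, sub_zero, zero_le_one, sup_of_le_left, smul_eq_mul, mul_one]
  unfold pressureConst
  ring

end profile

lemma abs_div_sub_div_le {p p' r r' r₀ P A B : ℝ} (hr₀ : 0 < r₀) (hr : r₀ ≤ r) (hr' : r₀ ≤ r')
    (hP : |p'| ≤ P) (hp : |p - p'| ≤ A) (hrr : |r - r'| ≤ B) :
    |p / r - p' / r'| ≤ A / r₀ + P * B / (r₀ * r₀) := by
  have h0 : 0 < r := hr₀.trans_le hr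
  have h0' : 0 < r' := hr₀.trans_le hr'
  have hA := (abs_nonneg _).trans hp
  have hB := (abs_nonneg _).trans hrr
  have hP0 := (abs_nonneg _).trans hP
  rw [show p / r - p' / r' = (p - p') / r + -(p' * (r - r') / (r * r')) by field_simp; ring]
  refine (abs_add_le _ _).trans (add_le_add ?_ ?_)
  · rw [abs_div, abs_of_pos h0]
    gcongr
  · rw [abs_neg, abs_div, abs_mul, abs_of_pos (mul_pos h0 h0')]
    gcongr

/-- continuity of the steady-state map `T ↦ τ` in the uniform norm. -/
theorem steady_state_map_continuous :
    ∃ Θ : ℝ, 1 ≤ Θ ∧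
      ∀ T₁ T₂ : ℝ, Θ ≤ T₁ → T₁ ≤ T₂ →
        ∃ C Λ : ℝ, 0 < C ∧ 0 < Λ ∧
          ∀ ρ ρ' T T' : ℝ → ℝ, ∀ f f' : ℝ → ℝ → ℝ,
            Measurable ρ → Measurable ρ' →
            (∀ y ∈ Icc (0 : ℝ) 1, 0 < ρ y) → (∀ y ∈ Icc (0 : ℝ) 1, 0 < ρ' y) →
            (∃ B : ℝ, ∀ y ∈ Icc (0 : ℝ) 1, ρ y ≤ B ∧ ρ' y ≤ B) →
            (∫ y in Icc (0 : ℝ) 1, ρ y) = 1 → (∫ y in Icc (0 : ℝ) 1, ρ' y) = 1 →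
            Measurable T → Measurable T' → (∀ y, 0 < T y) → (∀ y, 0 < T' y) →
            (∀ y ∈ Icc (0 : ℝ) 1, T₁ ≤ T y ∧ T y ≤ T₂) →
            (∀ y ∈ Icc (0 : ℝ) 1, T₁ ≤ T' y ∧ T' y ≤ T₂) →
            (∀ x v, 0 ≤ f x v) → (∀ x v, 0 ≤ f' x v) →
            IsMildSteadyState 1 T₁ T₂ ρ T f →
            IsMildSteadyState 1 T₁ T₂ ρ' T' f' →
            (∀ x₁ ∈ Icc (0 : ℝ) 1, ∀ x₂ ∈ Icc (0 : ℝ) 1,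
              (∫ v, v ^ 2 * f x₁ v) = ∫ v, v ^ 2 * f x₂ v) →
            (∀ x₁ ∈ Icc (0 : ℝ) 1, ∀ x₂ ∈ Icc (0 : ℝ) 1,
              (∫ v, v ^ 2 * f' x₁ v) = ∫ v, v ^ 2 * f' x₂ v) →
            (∀ x ∈ Icc (0 : ℝ) 1,
              |ρ x - ρ' x| ≤ C * T₁ ^ (-(1 : ℝ) / 2) *
                sSup ((fun y => |Real.sqrt (T y) - Real.sqrt (T' y)|) '' Icc (0 : ℝ) 1)) ∧
            (∀ x ∈ Icc (0 : ℝ) 1,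
              |(∫ v, v ^ 2 * f x v) / ρ x - (∫ v, v ^ 2 * f' x v) / ρ' x| ≤
                Λ * sSup ((fun y => |Real.sqrt (T y) - Real.sqrt (T' y)|) '' Icc (0 : ℝ) 1)) := by
  obtain ⟨Θ, hΘ, hot⟩ := exists_isHot
  refine ⟨Θ, hΘ, fun T₁ T₂ hT₁ hT₁₂ => ?_⟩
  have hT₁' := hot T₁ hT₁
  have hT₁0 : 0 < T₁ := by linarith
  have hs₁ : 0 < √T₁ := Real.sqrt_pos.2 hT₁0
  set r₀ := √(2 * π) / √T₁ / 16 with hr₀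
  have hr₀0 : 0 < r₀ := by positivity
  have hc := fracMoment_pos
  have hdc := densityConst_pos
  have hsq := sqBound_nonneg (T₂ := T₂) (by linarith)
  have hΛ : 0 < pressureConst T₂ / r₀ + pressureBound T₂ * densityConst / (r₀ * r₀) := by
    unfold pressureConst pressureBound
    positivity
  refine ⟨densityConst * √T₁, _, by positivity, hΛ, ?_⟩
  intro ρ ρ' T T' f f' hρ hρ' hρ0 hρ0' hB hm hm' hT hT' hT0 hT0' hTb hTb' _ _ hf hf' _ _
  obtain ⟨B, hB⟩ := hB
  have h : IsProfile T₁ T₂ ρ T := ⟨hρ, hρ0, ⟨B, fun y hy => (hB y hy).1⟩, hm, hT, hT0,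
    fun y hy => (hTb y hy).1, fun y hy => (hTb y hy).2⟩
  have h' : IsProfile T₁ T₂ ρ' T' := ⟨hρ', hρ0', ⟨B, fun y hy => (hB y hy).2⟩, hm', hT', hT0',
    fun y hy => (hTb' y hy).1, fun y hy => (hTb' y hy).2⟩
  set D := sSup ((fun y => |√(T y) - √(T' y)|) '' Icc (0 : ℝ) 1)
  have hbdd : BddAbove ((fun y => |√(T y) - √(T' y)|) '' Icc (0 : ℝ) 1) := by
    refine ⟨√T₂, ?_⟩
    rintro _ ⟨y, hy, rfl⟩
    have h1 := Real.sqrt_le_sqrt (hTb y hy).2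
    have h2 := Real.sqrt_le_sqrt (hTb' y hy).2
    exact abs_le.2 ⟨by linarith [Real.sqrt_nonneg (T y)], by linarith [Real.sqrt_nonneg (T' y)]⟩
  have hD : ∀ y ∈ Icc (0 : ℝ) 1, |√(T y) - √(T' y)| ≤ D := fun y hy =>
    le_csSup hbdd ⟨y, hy, rfl⟩
  have hdens := h.abs_density_sub_le h' hT₁' hf hf' hD
  refine ⟨fun x hx => (hdens x hx).trans (le_of_eq ?_), fun x hx => ?_⟩
  · rw [show (-(1 : ℝ) / 2) = -(1 / 2) by norm_num, Real.rpow_neg hT₁0.le, ← Real.sqrt_eq_rpow,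
      mul_inv_cancel_right₀ hs₁.ne']
  · refine (abs_div_sub_div_le hr₀0 (h.le_density hT₁' hf hx) (h'.le_density hT₁' hf' hx)
      (h'.abs_pressure_le hT₁' hf' hx) (h.abs_pressure_sub_le h' hT₁' hf hf' hD hx)
      (hdens x hx)).trans (le_of_eq ?_)
    ring
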